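/- arXiv:2209.14724 — 13 statements merged into one kernel-verified Lean document; each statement's English description precedes it below -/
import Mathlib

section
/- Let (X,d) be a metric space and consider the Lorentzian product ℝ × X. Then the causal relation ≤ is reflexive and transitive, the timelike relation ≪ is transitive and contained in ≤, τ(p,q) > 0 if and only if p ≪ q, τ(p,q) = 0 whenever p ≤ q fails, and the reverse triangle inequality holds: for all p, q, r ∈ ℝ × X with p ≤ q ≤ r one has τ(p,r) ≥ τ(p,q) + τ(q,r). (Hence the Lorentzian product is a Lorentzian pre-length space.) -/
/-!
Statement 0: The Lorentzian product `ℝ × X` of a metric space `(X,d)` is a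
Lorentzian pre-length space: the causal relation is reflexive and transitive,
the timelike relation is transitive and contained in the causal one,
`τ(p,q) > 0 ↔ p ≪ q`, `τ(p,q) = 0` whenever `p ≤ q` fails, and the reverse
triangle inequality holds.
-/

variable {X : Type*} [MetricSpace X]

/-- Causal relation of the Lorentzian product `ℝ × X`:
`(s,x) ≤ (t,y) ↔ t - s ≥ d(x,y)`. -/
def LorCausal (p q : ℝ × X) : Prop := dist p.2 q.2 ≤ q.1 - p.1

/-- Timelike relation of the Lorentzian product `ℝ × X`:
`(s,x) ≪ (t,y) ↔ t - s > d(x,y)`. -/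
def LorChron (p q : ℝ × X) : Prop := dist p.2 q.2 < q.1 - p.1

/-- Time separation of the Lorentzian product `ℝ × X`:
`τ((s,x),(t,y)) = √((t-s)² - d(x,y)²)` if `(s,x) ≤ (t,y)`, and `0` otherwise. -/
noncomputable def LorTau (p q : ℝ × X) : ℝ :=
  if dist p.2 q.2 ≤ q.1 - p.1 then Real.sqrt ((q.1 - p.1) ^ 2 - dist p.2 q.2 ^ 2) else 0

/-- The reverse triangle inequality in the two-dimensional Minkowski cone. -/
theorem sqrt_sq_sub_sq_add_le {a b c d e : ℝ} (hc : 0 ≤ c) (hd : 0 ≤ d) (he : 0 ≤ e)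
    (hca : c ≤ a) (hdb : d ≤ b) (hecd : e ≤ c + d) :
    √(a ^ 2 - c ^ 2) + √(b ^ 2 - d ^ 2) ≤ √((a + b) ^ 2 - e ^ 2) := by
  have hac : 0 ≤ a ^ 2 - c ^ 2 := sub_nonneg.2 (pow_le_pow_left₀ hc hca 2)
  have hbd : 0 ≤ b ^ 2 - d ^ 2 := sub_nonneg.2 (pow_le_pow_left₀ hd hdb 2)
  have hprod : √(a ^ 2 - c ^ 2) * √(b ^ 2 - d ^ 2) ≤ a * b - c * d := by
    rw [← Real.sqrt_mul hac]
    refine Real.sqrt_le_iff.2 ⟨sub_nonneg.2 (mul_le_mul hca hdb hd (hc.trans hca)), ?_⟩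
    nlinarith [sq_nonneg (a * d - b * c)]
  have hsq : e ^ 2 ≤ (c + d) ^ 2 := pow_le_pow_left₀ he hecd 2
  apply Real.le_sqrt_of_sq_le
  nlinarith [Real.sq_sqrt hac, Real.sq_sqrt hbd]

theorem LorChron.causal {p q : ℝ × X} (h : LorChron p q) : LorCausal p q := le_of_lt h

theorem LorCausal.trans {p q r : ℝ × X} (hpq : LorCausal p q) (hqr : LorCausal q r) :
    LorCausal p r := by
  unfold LorCausal at *
  linarith [dist_triangle p.2 q.2 r.2]

theorem LorChron.trans {p q r : ℝ × X} (hpq : LorChron p q) (hqr : LorChron q r) :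
    LorChron p r := by
  unfold LorChron at *
  linarith [dist_triangle p.2 q.2 r.2]

theorem LorTau_of_causal {p q : ℝ × X} (h : LorCausal p q) :
    LorTau p q = √((q.1 - p.1) ^ 2 - dist p.2 q.2 ^ 2) := if_pos h

theorem LorTau_of_not_causal {p q : ℝ × X} (h : ¬ LorCausal p q) : LorTau p q = 0 := if_neg h

theorem LorTau_pos_iff {p q : ℝ × X} : 0 < LorTau p q ↔ LorChron p q := by
  by_cases h : LorCausal p q
  · rw [LorTau_of_causal h, Real.sqrt_pos, sub_pos]
    exact pow_lt_pow_iff_left₀ dist_nonneg (dist_nonneg.trans h) two_ne_zero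
  · rw [LorTau_of_not_causal h]
    exact iff_of_false (lt_irrefl 0) fun h' => h h'.causal

theorem LorTau_add_le {p q r : ℝ × X} (hpq : LorCausal p q) (hqr : LorCausal q r) :
    LorTau p q + LorTau q r ≤ LorTau p r := by
  rw [LorTau_of_causal hpq, LorTau_of_causal hqr, LorTau_of_causal (hpq.trans hqr),
    show r.1 - p.1 = (q.1 - p.1) + (r.1 - q.1) by ring]
  exact sqrt_sq_sub_sq_add_le dist_nonneg dist_nonneg dist_nonneg hpq hqr (dist_triangle _ _ _)

theorem lorentzian_product_is_prelength_space (X : Type*) [MetricSpace X] :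
    (∀ p : ℝ × X, LorCausal p p) ∧
    (∀ p q r : ℝ × X, LorCausal p q → LorCausal q r → LorCausal p r) ∧
    (∀ p q r : ℝ × X, LorChron p q → LorChron q r → LorChron p r) ∧
    (∀ p q : ℝ × X, LorChron p q → LorCausal p q) ∧
    (∀ p q : ℝ × X, 0 < LorTau p q ↔ LorChron p q) ∧
    (∀ p q : ℝ × X, ¬ LorCausal p q → LorTau p q = 0) ∧
    (∀ p q r : ℝ × X, LorCausal p q → LorCausal q r →
      LorTau p q + LorTau q r ≤ LorTau p r) := by
  exact ⟨fun p => by simp [LorCausal], fun _ _ _ => LorCausal.trans, fun _ _ _ => LorChron.trans,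
    fun _ _ => LorChron.causal, fun _ _ => LorTau_pos_iff, fun _ _ => LorTau_of_not_causal,
    fun _ _ _ => LorTau_add_le⟩
end

section
/- Let (X,d) be a metric space. Then the time separation τ of the Lorentzian product ℝ × X is continuous as a function (ℝ × X) × (ℝ × X) → ℝ, where ℝ × X carries the topology induced by the metric D. -/
/-!
Statement 1: The time separation `τ` of the Lorentzian product `ℝ × X` is
continuous as a function `(ℝ × X) × (ℝ × X) → ℝ`, where `ℝ × X` carries the
topology induced by the metric `D((s,x),(t,y)) = √((t-s)² + d(x,y)²)`.
Continuity is expressed in `ε`-`δ` form directly with respect to `D`.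
-/

variable {X : Type*} [MetricSpace X]

/-- The product metric `D((s,x),(t,y)) = √((t-s)² + d(x,y)²)`. -/
noncomputable def LorD (p q : ℝ × X) : ℝ :=
  Real.sqrt ((q.1 - p.1) ^ 2 + dist p.2 q.2 ^ 2)

theorem lorTau_eq_sqrt_max_mul (p q : ℝ × X) :
    LorTau p q =
      Real.sqrt (max (q.1 - p.1 - dist p.2 q.2) 0 * (q.1 - p.1 + dist p.2 q.2)) := by
  unfold LorTau
  split_ifs with h
  · rw [max_eq_left (sub_nonneg.2 h)]
    congr 1
    ring
  · rw [max_eq_right (by linarith), zero_mul, Real.sqrt_zero]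

theorem continuous_lorTau :
    Continuous fun z : (ℝ × X) × (ℝ × X) => LorTau z.1 z.2 := by
  simp only [lorTau_eq_sqrt_max_mul]
  fun_prop

theorem dist_le_lorD (p q : ℝ × X) : dist p q ≤ LorD p q := by
  rw [Prod.dist_eq, Real.dist_eq, abs_sub_comm]
  refine max_le (Real.abs_le_sqrt ?_) (Real.le_sqrt_of_sq_le ?_)
  · exact le_add_of_nonneg_right (sq_nonneg _)
  · exact le_add_of_nonneg_left (sq_nonneg _)

theorem lorentzian_product_tau_continuous (X : Type*) [MetricSpace X] :
    ∀ p q : ℝ × X, ∀ ε : ℝ, 0 < ε → ∃ δ : ℝ, 0 < δ ∧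
      ∀ p' q' : ℝ × X, LorD p p' < δ → LorD q q' < δ →
        |LorTau p' q' - LorTau p q| < ε := by
  intro p q ε hε
  obtain ⟨δ, hδ, h⟩ :=
    Metric.continuous_iff.1 (continuous_lorTau (X := X)) (p, q) ε hε
  refine ⟨δ, hδ, fun p' q' hp hq => ?_⟩
  rw [← Real.dist_eq]
  refine h (p', q') ?_
  rw [dist_comm, Prod.dist_eq]
  exact max_lt ((dist_le_lorD p p').trans_lt hp) ((dist_le_lorD q q').trans_lt hq)
end

section
/- Let (X,d) be a metric space and for p, q ∈ ℝ × X define the timelike diamond I(p,q) = {r ∈ ℝ × X : p ≪ r ≪ q}. Then the family {I(p,q) : p, q ∈ ℝ × X} is a basis for the topology on ℝ × X induced by the metric D. (In particular, the Lorentzian product is strongly causal.) -/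
/-!
Statement 3: The timelike diamonds `I(p,q) = {r : p ≪ r ≪ q}` form a basis of
the topology on the Lorentzian product `ℝ × X` induced by the metric `D`.
This is expressed directly in terms of `D`-balls: every timelike diamond is
`D`-open, and every `D`-ball around a point contains a timelike diamond
containing that point.
-/

variable {X : Type*} [MetricSpace X]

theorem abs_sub_fst_le_lorD (p q : ℝ × X) : |q.1 - p.1| ≤ LorD p q :=
  Real.abs_le_sqrt (le_add_of_nonneg_right (sq_nonneg _))

theorem dist_snd_le_lorD (p q : ℝ × X) : dist p.2 q.2 ≤ LorD p q :=
  Real.le_sqrt_of_sq_le (le_add_of_nonneg_left (sq_nonneg _))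

theorem lorD_le_abs_sub_add_dist (p q : ℝ × X) :
    LorD p q ≤ |q.1 - p.1| + dist p.2 q.2 := by
  have hd : 0 ≤ dist p.2 q.2 := dist_nonneg
  refine Real.sqrt_le_iff.mpr ⟨by positivity, ?_⟩
  nlinarith [sq_abs (q.1 - p.1), mul_nonneg (abs_nonneg (q.1 - p.1)) hd]

theorem lorentzian_product_diamonds_form_basis (X : Type*) [MetricSpace X] :
    -- every timelike diamond `I(p,q)` is open for the metric `D`
    (∀ p q z : ℝ × X, LorChron p z → LorChron z q →
      ∃ ε : ℝ, 0 < ε ∧ ∀ w : ℝ × X, LorD z w < ε → LorChron p w ∧ LorChron w q) ∧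
    -- every `D`-ball around a point contains a diamond containing that point
    (∀ z : ℝ × X, ∀ ε : ℝ, 0 < ε → ∃ p q : ℝ × X,
      (LorChron p z ∧ LorChron z q) ∧
      ∀ w : ℝ × X, LorChron p w → LorChron w q → LorD z w < ε) := by
  refine ⟨fun p q z hpz hzq => ?_, fun z ε hε => ?_⟩
  · simp only [LorChron] at hpz hzq ⊢
    refine ⟨min (z.1 - p.1 - dist p.2 z.2) (q.1 - z.1 - dist z.2 q.2) / 2,
      half_pos (lt_min (by linarith) (by linarith)), fun w hw => ?_⟩
    have hp := min_le_left (z.1 - p.1 - dist p.2 z.2) (q.1 - z.1 - dist z.2 q.2)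
    have hq := min_le_right (z.1 - p.1 - dist p.2 z.2) (q.1 - z.1 - dist z.2 q.2)
    have ht := abs_le.mp (abs_sub_fst_le_lorD z w)
    have hx := dist_snd_le_lorD z w
    have hpw := dist_triangle p.2 z.2 w.2
    have hwq := dist_triangle_left w.2 q.2 z.2
    constructor <;> linarith [ht.1, ht.2]
  · simp only [LorChron]
    refine ⟨(z.1 - ε / 2, z.2), (z.1 + ε / 2, z.2), ?_, fun w hpw hwq => ?_⟩
    · constructor <;> simp [hε]
    · rw [dist_comm w.2] at hwq
      have ht : |w.1 - z.1| < ε / 2 - dist z.2 w.2 :=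
        abs_lt.mpr ⟨by linarith, by linarith⟩
      linarith [lorD_le_abs_sub_add_dist z w]
end

section
/- Let (X,d) be a metric space and let γ = (α,β) : [a,b] → ℝ × X be any map such that γ(u) ≤ γ(v) in the Lorentzian product whenever a ≤ u ≤ v ≤ b. Then for every partition a = t_0 < t_1 < ... < t_N = b one has Σ_{i=0}^{N−1} D(γ(t_i),γ(t_{i+1})) ≤ sqrt(2)·(α(b) − α(a)); consequently the D-length (total variation with respect to D) of γ is at most sqrt(2)·(α(b) − α(a)). In particular, for every compact set K ⊆ ℝ × X there is a constant C > 0 bounding the D-length of every such causal curve with image contained in K, i.e. the Lorentzian product is non-totally imprisoning. -/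
/-!
Statement 5: For a causal curve `γ = (α,β) : [a,b] → ℝ × X` in the Lorentzian
product, every partition sum of `D`-distances is bounded by `√2·(α(b) - α(a))`,
hence the `D`-length (total variation w.r.t. `D`) of `γ` is at most
`√2·(α(b) - α(a))`.  In particular, for every compact `K ⊆ ℝ × X` there is a
constant `C > 0` bounding the `D`-length of every causal curve with image in
`K`: the Lorentzian product is non-totally imprisoning.
-/

variable {X : Type*} [MetricSpace X]

/-- The set of partition sums of `D`-distances of `γ` over partitions of `[a,b]`;
its supremum is the `D`-length (total variation) of `γ` on `[a,b]`. -/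
noncomputable def partitionSums (γ : ℝ → ℝ × X) (a b : ℝ) : Set ℝ :=
  {S : ℝ | ∃ (N : ℕ) (t : ℕ → ℝ), 0 < N ∧ t 0 = a ∧ t N = b ∧
    (∀ i, i < N → t i < t (i + 1)) ∧
    S = ∑ i ∈ Finset.range N, LorD (γ (t i)) (γ (t (i + 1)))}

theorem LorCausal.lorD_le {X : Type*} [MetricSpace X] {p q : ℝ × X} (h : LorCausal p q) :
    LorD p q ≤ Real.sqrt 2 * (q.1 - p.1) := by
  have hd : dist p.2 q.2 ≤ q.1 - p.1 := h
  have h0 : 0 ≤ q.1 - p.1 := dist_nonneg.trans hd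
  have hsq : dist p.2 q.2 ^ 2 ≤ (q.1 - p.1) ^ 2 := by gcongr
  refine Real.sqrt_le_iff.mpr ⟨by positivity, ?_⟩
  rw [mul_pow, Real.sq_sqrt zero_le_two]
  linarith

theorem sum_lorD_le {X : Type*} [MetricSpace X] {a b : ℝ} {γ : ℝ → ℝ × X}
    (hγ : ∀ u v, a ≤ u → u ≤ v → v ≤ b → LorCausal (γ u) (γ v))
    {N : ℕ} {t : ℕ → ℝ} (ha : t 0 = a) (hb : t N = b) (ht : ∀ i, i < N → t i < t (i + 1)) :
    ∑ i ∈ Finset.range N, LorD (γ (t i)) (γ (t (i + 1)))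
      ≤ Real.sqrt 2 * ((γ b).1 - (γ a).1) := by
  have hmono : MonotoneOn t (Set.Icc 0 N) :=
    monotoneOn_of_le_add_one Set.ordConnected_Icc fun i _ _ hi => (ht i hi.2).le
  calc ∑ i ∈ Finset.range N, LorD (γ (t i)) (γ (t (i + 1)))
      ≤ ∑ i ∈ Finset.range N, Real.sqrt 2 * ((γ (t (i + 1))).1 - (γ (t i)).1) := by
        refine Finset.sum_le_sum fun i hi => (hγ _ _ ?_ ?_ ?_).lorD_le
        all_goals have hi := Finset.mem_range.mp hi
        · rw [← ha]
          exact hmono ⟨le_rfl, by lia⟩ ⟨by lia, by lia⟩ (by lia)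
        · exact (ht i hi).le
        · rw [← hb]
          exact hmono ⟨by lia, by lia⟩ ⟨by lia, le_rfl⟩ (by lia)
    _ = Real.sqrt 2 * ((γ b).1 - (γ a).1) := by
        rw [← Finset.mul_sum, Finset.sum_range_sub (fun i => (γ (t i)).1), ha, hb]

theorem lorentzian_product_nontotally_imprisoning (X : Type*) [MetricSpace X]
    (a b : ℝ) (hab : a ≤ b) (γ : ℝ → ℝ × X)
    (hγ : ∀ u v, a ≤ u → u ≤ v → v ≤ b → LorCausal (γ u) (γ v)) :
    -- every partition sum is bounded by √2·(α(b) - α(a))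
    (∀ (N : ℕ) (t : ℕ → ℝ), 0 < N → t 0 = a → t N = b →
      (∀ i, i < N → t i < t (i + 1)) →
      ∑ i ∈ Finset.range N, LorD (γ (t i)) (γ (t (i + 1)))
        ≤ Real.sqrt 2 * ((γ b).1 - (γ a).1)) ∧
    -- hence the D-length of γ is at most √2·(α(b) - α(a))
    sSup (partitionSums γ a b) ≤ Real.sqrt 2 * ((γ b).1 - (γ a).1) ∧
    -- non-total imprisonment: a uniform bound on D-lengths of causal curves in
    -- any compact set
    (∀ K : Set (ℝ × X), IsCompact K → ∃ C : ℝ, 0 < C ∧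
      ∀ (a' b' : ℝ) (σ : ℝ → ℝ × X), a' ≤ b' →
        (∀ u v, a' ≤ u → u ≤ v → v ≤ b' → LorCausal (σ u) (σ v)) →
        (∀ u, a' ≤ u → u ≤ b' → σ u ∈ K) →
        ∀ S ∈ partitionSums σ a' b', S ≤ C) := by
  refine ⟨fun N t _ ha hb ht => sum_lorD_le hγ ha hb ht, ?_, fun K hK => ?_⟩
  · refine Real.sSup_le ?_ ?_
    · rintro S ⟨N, t, -, ha, hb, ht, rfl⟩
      exact sum_lorD_le hγ ha hb ht
    · exact mul_nonneg (Real.sqrt_nonneg 2) (dist_nonneg.trans (hγ a b le_rfl hab le_rfl))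
  · refine ⟨Real.sqrt 2 * Metric.diam K + 1, by positivity, ?_⟩
    rintro a' b' σ hab' hσ hσK S ⟨N, t, -, ha, hb, ht, rfl⟩
    have hdiam : (σ b').1 - (σ a').1 ≤ Metric.diam K :=
      calc (σ b').1 - (σ a').1 ≤ dist (σ b').1 (σ a').1 := le_abs_self _
        _ ≤ dist (σ b') (σ a') := le_max_left _ _
        _ ≤ Metric.diam K :=
          Metric.dist_le_diam_of_mem hK.isBounded (hσK b' hab' le_rfl) (hσK a' le_rfl hab')
    calc _ ≤ Real.sqrt 2 * ((σ b').1 - (σ a').1) := sum_lorD_le hσ ha hb ht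
      _ ≤ Real.sqrt 2 * Metric.diam K := by gcongr
      _ ≤ Real.sqrt 2 * Metric.diam K + 1 := by linarith
end

section
/- Let (X,d) be a metric space and γ = (α,β) : [a,b] → ℝ × X a continuous non-constant curve which is future-directed causal, i.e. α(v) − α(u) ≥ d(β(u),β(v)) for all a ≤ u ≤ v ≤ b. Then γ maximises the time separation between all of its points, i.e. τ(γ(r),γ(t)) = τ(γ(r),γ(s)) + τ(γ(s),γ(t)) for all a ≤ r ≤ s ≤ t ≤ b, if and only if there exists k ∈ [0,1] such that d(β(u),β(v)) = k·(α(v) − α(u)) for all a ≤ u ≤ v ≤ b. In that case τ(γ(u),γ(v)) = sqrt(1 − k^2)·(α(v) − α(u)) for all u ≤ v; in particular β is a metric distance realiser, and either k < 1 and γ(u) ≪ γ(v) for all u < v with γ(u) ≠ γ(v) (γ is timelike), or k = 1 and no two points on γ are ≪-related (γ is null). -/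
/-!
Statement 6: Characterisation of distance realisers in the Lorentzian product
`ℝ × X`: a continuous non-constant future-directed causal curve
`γ = (α,β) : [a,b] → ℝ × X` maximises the time separation between all of its
points iff the spatial distance is proportional to the elapsed time with a
constant ratio `k ∈ [0,1]`; in that case `τ(γ(u),γ(v)) = √(1-k²)·(α(v)-α(u))`,
`β` is a metric distance realiser, and `γ` is timelike if `k < 1` and null if
`k = 1`.
-/

variable {X : Type*} [MetricSpace X]

/-- Equality case of the reverse triangle inequality in the Minkowski plane. -/
theorem eq_and_proportional_of_sqrt_add_eq {A B x y z : ℝ} (hx : 0 ≤ x) (hy : 0 ≤ y)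
    (hz : 0 ≤ z) (hxA : x ≤ A) (hyB : y ≤ B) (hzxy : z ≤ x + y)
    (h : √((A + B) ^ 2 - z ^ 2) = √(A ^ 2 - x ^ 2) + √(B ^ 2 - y ^ 2)) :
    z = x + y ∧ A * y = B * x := by
  have hp := Real.sq_sqrt (show 0 ≤ A ^ 2 - x ^ 2 by nlinarith)
  have hq := Real.sq_sqrt (show 0 ≤ B ^ 2 - y ^ 2 by nlinarith)
  have hw := Real.sq_sqrt (show 0 ≤ (A + B) ^ 2 - z ^ 2 by nlinarith)
  rw [h] at hw
  set p := √(A ^ 2 - x ^ 2)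
  set q := √(B ^ 2 - y ^ 2)
  have hxy : x * y ≤ A * B := mul_le_mul hxA hyB hy (hx.trans hxA)
  have hsq : (A * B - x * y) ^ 2 - (p * q) ^ 2 = (A * y - B * x) ^ 2 := by
    rw [mul_pow, hp, hq]; ring
  have hpq : p * q ≤ A * B - x * y :=
    abs_le_of_sq_le_sq' (by nlinarith [sq_nonneg (A * y - B * x)]) (by linarith) |>.2
  have hz2 : z ^ 2 ≤ (x + y) ^ 2 := by gcongr
  have heq : p * q = A * B - x * y := by nlinarith
  refine ⟨?_, ?_⟩
  · exact (sq_eq_sq₀ hz (add_nonneg hx hy)).1 (by nlinarith)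
  · rw [heq, sub_self] at hsq
    exact sub_eq_zero.1 (pow_eq_zero_iff two_ne_zero |>.1 hsq.symm)

/-- If a causal point triple realises equality in the reverse triangle inequality for the time
separation, then the spatial distances add up and are proportional to the elapsed times. -/
theorem LorTau.dist_add_and_proportional {X : Type*} [MetricSpace X] {p q r : ℝ × X}
    (hpq : LorCausal p q) (hqr : LorCausal q r) (h : LorTau p r = LorTau p q + LorTau q r) :
    dist p.2 r.2 = dist p.2 q.2 + dist q.2 r.2 ∧
      (q.1 - p.1) * dist q.2 r.2 = (r.1 - q.1) * dist p.2 q.2 := by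
  unfold LorCausal at hpq hqr
  have htri := dist_triangle p.2 q.2 r.2
  have hpr : dist p.2 r.2 ≤ r.1 - p.1 := by linarith
  simp only [LorTau, if_pos hpq, if_pos hqr, if_pos hpr] at h
  refine eq_and_proportional_of_sqrt_add_eq dist_nonneg dist_nonneg dist_nonneg hpq hqr htri ?_
  rwa [show q.1 - p.1 + (r.1 - q.1) = r.1 - p.1 by ring]

theorem lorentzian_product_distance_realisers (X : Type*) [MetricSpace X]
    (a b : ℝ) (hab : a ≤ b) (γ : ℝ → ℝ × X)
    (hcont : ContinuousOn γ (Set.Icc a b))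
    (hnonconst : ∃ u ∈ Set.Icc a b, ∃ v ∈ Set.Icc a b, γ u ≠ γ v)
    (hcausal : ∀ u v, a ≤ u → u ≤ v → v ≤ b → LorCausal (γ u) (γ v)) :
    -- γ is maximising iff the spatial distance is a constant fraction
    -- k ∈ [0,1] of the elapsed time
    ((∀ r s t, a ≤ r → r ≤ s → s ≤ t → t ≤ b →
        LorTau (γ r) (γ t) = LorTau (γ r) (γ s) + LorTau (γ s) (γ t)) ↔
      (∃ k : ℝ, 0 ≤ k ∧ k ≤ 1 ∧ ∀ u v, a ≤ u → u ≤ v → v ≤ b →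
        dist (γ u).2 (γ v).2 = k * ((γ v).1 - (γ u).1))) ∧
    -- and in that case:
    (∀ k : ℝ, 0 ≤ k → k ≤ 1 →
      (∀ u v, a ≤ u → u ≤ v → v ≤ b →
        dist (γ u).2 (γ v).2 = k * ((γ v).1 - (γ u).1)) →
      -- the time separation along γ
      (∀ u v, a ≤ u → u ≤ v → v ≤ b →
        LorTau (γ u) (γ v) = Real.sqrt (1 - k ^ 2) * ((γ v).1 - (γ u).1)) ∧
      -- β is a metric distance realiser
      (∀ r s t, a ≤ r → r ≤ s → s ≤ t → t ≤ b →
        dist (γ r).2 (γ s).2 + dist (γ s).2 (γ t).2 = dist (γ r).2 (γ t).2) ∧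
      -- k < 1 : γ is timelike
      (k < 1 → ∀ u v, a ≤ u → u < v → v ≤ b → γ u ≠ γ v → LorChron (γ u) (γ v)) ∧
      -- k = 1 : γ is null
      (k = 1 → ∀ u v, a ≤ u → u ≤ b → a ≤ v → v ≤ b → ¬ LorChron (γ u) (γ v))) := by
  have hmono : ∀ u v, a ≤ u → u ≤ v → v ≤ b → (γ u).1 ≤ (γ v).1 := fun u v hu huv hv =>
    sub_nonneg.1 (dist_nonneg.trans (hcausal u v hu huv hv))
  have htau : ∀ k : ℝ, 0 ≤ k → k ≤ 1 →
      (∀ u v, a ≤ u → u ≤ v → v ≤ b →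
        dist (γ u).2 (γ v).2 = k * ((γ v).1 - (γ u).1)) →
      ∀ u v, a ≤ u → u ≤ v → v ≤ b →
        LorTau (γ u) (γ v) = Real.sqrt (1 - k ^ 2) * ((γ v).1 - (γ u).1) := by
    intro k hk0 hk1 hk u v hu huv hv
    have hcau := hcausal u v hu huv hv
    unfold LorCausal at hcau
    rw [LorTau, if_pos hcau, hk u v hu huv hv,
      show ((γ v).1 - (γ u).1) ^ 2 - (k * ((γ v).1 - (γ u).1)) ^ 2
        = (1 - k ^ 2) * ((γ v).1 - (γ u).1) ^ 2 by ring,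
      Real.sqrt_mul (by nlinarith), Real.sqrt_sq (sub_nonneg.2 (hmono u v hu huv hv))]
  refine ⟨⟨fun hmax => ?_, ?_⟩, fun k hk0 hk1 hk => ⟨htau k hk0 hk1 hk, ?_, ?_, ?_⟩⟩
  · have hpos : 0 < (γ b).1 - (γ a).1 := by
      refine (sub_nonneg.2 (hmono a b le_rfl hab le_rfl)).lt_of_ne fun h0 => ?_
      have hconst : ∀ u ∈ Set.Icc a b, γ u = γ a := by
        intro u hu
        have h1 := hmono a u le_rfl hu.1 hu.2
        have h2 := hmono u b hu.1 hu.2 le_rfl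
        have h3 : dist (γ a).2 (γ u).2 ≤ (γ u).1 - (γ a).1 := hcausal a u le_rfl hu.1 hu.2
        have h4 : (γ u).1 = (γ a).1 := by linarith
        exact Prod.ext h4 (dist_le_zero.1 (by linarith)).symm
      obtain ⟨u, hu, v, hv, huv⟩ := hnonconst
      exact huv ((hconst u hu).trans (hconst v hv).symm)
    have hend : dist (γ a).2 (γ b).2 ≤ (γ b).1 - (γ a).1 := hcausal a b le_rfl hab le_rfl
    have hsplit : ∀ r s t, a ≤ r → r ≤ s → s ≤ t → t ≤ b →
        dist (γ r).2 (γ t).2 = dist (γ r).2 (γ s).2 + dist (γ s).2 (γ t).2 ∧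
          ((γ s).1 - (γ r).1) * dist (γ s).2 (γ t).2
            = ((γ t).1 - (γ s).1) * dist (γ r).2 (γ s).2 := fun r s t hr hrs hst ht =>
      LorTau.dist_add_and_proportional (hcausal r s hr hrs (hst.trans ht))
        (hcausal s t (hr.trans hrs) hst ht) (hmax r s t hr hrs hst ht)
    have hinit : ∀ u, a ≤ u → u ≤ b → dist (γ a).2 (γ u).2 * ((γ b).1 - (γ a).1)
        = dist (γ a).2 (γ b).2 * ((γ u).1 - (γ a).1) := by
      intro u hau hub
      obtain ⟨h1, h2⟩ := hsplit a u b le_rfl hau hub le_rfl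
      rw [h1]
      linarith
    refine ⟨dist (γ a).2 (γ b).2 / ((γ b).1 - (γ a).1), div_nonneg dist_nonneg hpos.le,
      (div_le_one hpos).2 hend, fun u v hu huv hv => ?_⟩
    have h1 := hinit u hu (huv.trans hv)
    have h2 := hinit v (hu.trans huv) hv
    rw [(hsplit a u v le_rfl hu huv hv).1] at h2
    rw [div_mul_eq_mul_div, eq_div_iff hpos.ne']
    linarith
  · rintro ⟨k, hk0, hk1, hk⟩ r s t hr hrs hst ht
    rw [htau k hk0 hk1 hk r t hr (hrs.trans hst) ht,
      htau k hk0 hk1 hk r s hr hrs (hst.trans ht),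
      htau k hk0 hk1 hk s t (hr.trans hrs) hst ht]
    ring
  · intro r s t hr hrs hst ht
    rw [hk r t hr (hrs.trans hst) ht, hk r s hr hrs (hst.trans ht), hk s t (hr.trans hrs) hst ht]
    ring
  · intro hlt u v hu huv hv hne
    have hd := hk u v hu huv.le hv
    have hpos : 0 < (γ v).1 - (γ u).1 := by
      refine (sub_nonneg.2 (hmono u v hu huv.le hv)).lt_of_ne fun h0 => hne ?_
      rw [← h0, mul_zero] at hd
      exact Prod.ext (sub_eq_zero.1 h0.symm).symm (dist_eq_zero.1 hd)
    rw [LorChron, hd]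
    exact mul_lt_of_lt_one_left hpos hlt
  · rintro rfl u v hu hub hv hvb hchron
    unfold LorChron at hchron
    rcases le_total u v with huv | hvu
    · have := hk u v hu huv hvb
      linarith
    · have := hmono v u hv hvu hub
      linarith [dist_nonneg (x := (γ u).2) (y := (γ v).2)]
end

section
/- Let (X,d) be a metric space and γ = (α,β) : [a,b] → ℝ × X a continuous non-constant curve with α(v) − α(u) ≥ d(β(u),β(v)) for all a ≤ u ≤ v ≤ b, which maximises the time separation between all of its points (τ(γ(r),γ(t)) = τ(γ(r),γ(s)) + τ(γ(s),γ(t)) for all r ≤ s ≤ t) and is timelike in the sense that L := τ(γ(a),γ(b)) > 0. Then there exist c ≥ 1, a curve γ̃ = (α̃,β̃) : [0,L] → ℝ × X and a continuous non-decreasing surjection φ : [a,b] → [0,L] such that γ = γ̃ ∘ φ, α̃(s) = α(a) + c·s for all s ∈ [0,L], d(β̃(u),β̃(v)) = sqrt(c^2 − 1)·(v − u) for all 0 ≤ u ≤ v ≤ L, and τ(γ̃(u),γ̃(v)) = v − u for all 0 ≤ u ≤ v ≤ L. In particular γ̃ is Lipschitz and is a parametrisation of γ by τ-arclength whose second component is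 a constant-speed metric minimiser of speed sqrt(c^2 − 1). -/
/-!
Statement 7: Every continuous timelike maximiser `γ = (α,β) : [a,b] → ℝ × X`
in the Lorentzian product admits a Lipschitz `τ`-arclength reparametrisation
`γ̃ : [0,L] → ℝ × X` (where `L = τ(γ(a),γ(b)) > 0`), of the form
`γ̃ = (α̃,β̃)` with `α̃(s) = α(a) + c·s` for some `c ≥ 1` and `β̃` a
constant-speed metric minimiser of speed `√(c²-1)`, and with
`τ(γ̃(u),γ̃(v)) = v - u`.
-/

variable {X : Type*} [MetricSpace X]

/-- Rigidity in the reverse triangle inequality for the Minkowski form on the causal cone. -/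
lemma eq_add_and_mul_eq_mul_of_sqrt_eq_add {S T d e f : ℝ} (hd : 0 ≤ d) (he : 0 ≤ e) (hf : 0 ≤ f)
    (hS : d ≤ S) (hT : e ≤ T) (hST : f ≤ S + T) (hfde : f ≤ d + e)
    (h : √((S + T) ^ 2 - f ^ 2) = √(S ^ 2 - d ^ 2) + √(T ^ 2 - e ^ 2)) :
    f = d + e ∧ S * e = T * d := by
  have hx := Real.sq_sqrt (show 0 ≤ S ^ 2 - d ^ 2 by nlinarith)
  have hy := Real.sq_sqrt (show 0 ≤ T ^ 2 - e ^ 2 by nlinarith)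
  have hz := Real.sq_sqrt (sub_nonneg.2 (pow_le_pow_left₀ hf hST 2))
  have hx0 := Real.sqrt_nonneg (S ^ 2 - d ^ 2)
  have hy0 := Real.sqrt_nonneg (T ^ 2 - e ^ 2)
  rw [h] at hz
  generalize √(S ^ 2 - d ^ 2) = x at *
  generalize √(T ^ 2 - e ^ 2) = y at *
  have hff : f ^ 2 ≤ (d + e) ^ 2 := pow_le_pow_left₀ hf hfde 2
  have hm : 0 ≤ S * T - d * e := sub_nonneg.2 (mul_le_mul hS hT he (hd.trans hS))
  have hxy : S * T - d * e ≤ x * y := by nlinarith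
  have hsq : (x * y) ^ 2 = (S * T - d * e) ^ 2 - (S * e - T * d) ^ 2 := by
    rw [mul_pow, hx, hy]; ring
  have hle := pow_le_pow_left₀ hm hxy 2
  have hzero : S * e - T * d = 0 := by
    have : (S * e - T * d) ^ 2 = 0 := le_antisymm (by linarith) (sq_nonneg _)
    exact pow_eq_zero_iff two_ne_zero |>.1 this
  rw [hzero] at hsq
  have hxy' : x * y = S * T - d * e :=
    (sq_eq_sq₀ (mul_nonneg hx0 hy0) hm).1 (by linarith)
  exact ⟨(sq_eq_sq₀ hf (add_nonneg hd he)).1 (by nlinarith), by linarith⟩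

lemma LorCausal.lorTau_eq {X : Type*} [MetricSpace X] {p q : ℝ × X} (h : LorCausal p q) :
    LorTau p q = √((q.1 - p.1) ^ 2 - dist p.2 q.2 ^ 2) :=
  if_pos h

/-- Equality in the reverse triangle inequality of the Lorentzian product forces the spatial
components to be aligned and the two segments to have the same velocity. -/
lemma LorCausal.dist_eq_add_and_mul_eq_mul {X : Type*} [MetricSpace X] {p q r : ℝ × X}
    (hpq : LorCausal p q) (hqr : LorCausal q r) (hpr : LorCausal p r)
    (h : LorTau p r = LorTau p q + LorTau q r) :
    dist p.2 r.2 = dist p.2 q.2 + dist q.2 r.2 ∧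
      (q.1 - p.1) * dist q.2 r.2 = (r.1 - q.1) * dist p.2 q.2 := by
  rw [hpq.lorTau_eq, hqr.lorTau_eq, hpr.lorTau_eq] at h
  have hsum : r.1 - p.1 = (q.1 - p.1) + (r.1 - q.1) := by ring
  have hpr' : dist p.2 r.2 ≤ r.1 - p.1 := hpr
  rw [hsum] at h hpr'
  exact eq_add_and_mul_eq_mul_of_sqrt_eq_add dist_nonneg dist_nonneg dist_nonneg hpq hqr hpr'
    (dist_triangle _ _ _) h

theorem lorentzian_product_tau_arclength_parametrisation
    (X : Type*) [MetricSpace X] (a b : ℝ) (hab : a ≤ b) (γ : ℝ → ℝ × X)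
    (hcont : ContinuousOn γ (Set.Icc a b))
    (hnonconst : ∃ u ∈ Set.Icc a b, ∃ v ∈ Set.Icc a b, γ u ≠ γ v)
    (hcausal : ∀ u v, a ≤ u → u ≤ v → v ≤ b → LorCausal (γ u) (γ v))
    (hmax : ∀ r s t, a ≤ r → r ≤ s → s ≤ t → t ≤ b →
      LorTau (γ r) (γ t) = LorTau (γ r) (γ s) + LorTau (γ s) (γ t))
    (htimelike : 0 < LorTau (γ a) (γ b)) :
    ∃ c : ℝ, 1 ≤ c ∧ ∃ γt : ℝ → ℝ × X, ∃ φ : ℝ → ℝ,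
      -- φ : [a,b] → [0,L] is a continuous non-decreasing surjection
      ContinuousOn φ (Set.Icc a b) ∧
      MonotoneOn φ (Set.Icc a b) ∧
      φ '' Set.Icc a b = Set.Icc 0 (LorTau (γ a) (γ b)) ∧
      -- γ = γ̃ ∘ φ on [a,b]
      (∀ u ∈ Set.Icc a b, γ u = γt (φ u)) ∧
      -- α̃(s) = α(a) + c·s
      (∀ s ∈ Set.Icc 0 (LorTau (γ a) (γ b)), (γt s).1 = (γ a).1 + c * s) ∧
      -- β̃ is a constant-speed metric minimiser of speed √(c²-1)
      (∀ u v, 0 ≤ u → u ≤ v → v ≤ LorTau (γ a) (γ b) →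
        dist (γt u).2 (γt v).2 = Real.sqrt (c ^ 2 - 1) * (v - u)) ∧
      -- γ̃ is parametrised by τ-arclength
      (∀ u v, 0 ≤ u → u ≤ v → v ≤ LorTau (γ a) (γ b) →
        LorTau (γt u) (γt v) = v - u) ∧
      -- in particular γ̃ is Lipschitz
      (∃ K : NNReal, LipschitzOnWith K γt (Set.Icc 0 (LorTau (γ a) (γ b)))) := by
  have hab' : LorCausal (γ a) (γ b) := hcausal a b le_rfl hab le_rfl
  set L := LorTau (γ a) (γ b) with hL
  set A := (γ b).1 - (γ a).1 with hA
  set D := dist (γ a).2 (γ b).2 with hD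
  have hD0 : 0 ≤ D := dist_nonneg
  have hDA : D ≤ A := hab'
  have hL2 : L ^ 2 = A ^ 2 - D ^ 2 := by
    rw [hL, hab'.lorTau_eq]
    exact Real.sq_sqrt (by nlinarith)
  have hA0 : 0 < A := by nlinarith
  have hLA : L ≤ A := by nlinarith
  have hstart : ∀ u ∈ Set.Icc a b, dist (γ a).2 (γ u).2 = ((γ u).1 - (γ a).1) * (D / A) := by
    intro u hu
    obtain ⟨h₁, h₂⟩ := (hcausal a u le_rfl hu.1 hu.2).dist_eq_add_and_mul_eq_mul
      (hcausal u b hu.1 hu.2 le_rfl) hab' (hmax a u b le_rfl hu.1 hu.2 le_rfl)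
    field_simp
    linear_combination (γ a).1 * h₁ - (γ u).1 * h₁ - h₂
  have hdist : ∀ u v, a ≤ u → u ≤ v → v ≤ b →
      dist (γ u).2 (γ v).2 = ((γ v).1 - (γ u).1) * (D / A) := by
    intro u v hu huv hv
    have h := ((hcausal a u le_rfl hu (huv.trans hv)).dist_eq_add_and_mul_eq_mul
      (hcausal u v hu huv hv) (hcausal a v le_rfl (hu.trans huv) hv)
      (hmax a u v le_rfl hu huv hv)).1
    rw [hstart u ⟨hu, huv.trans hv⟩, hstart v ⟨hu.trans huv, hv⟩] at h
    linarith
  have hmono : ∀ u v, a ≤ u → u ≤ v → v ≤ b → (γ u).1 ≤ (γ v).1 := fun u v hu huv hv =>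
    sub_nonneg.1 (dist_nonneg.trans (hcausal u v hu huv hv))
  set φ : ℝ → ℝ := fun u => ((γ u).1 - (γ a).1) * (L / A) with hφ
  have hφcont : ContinuousOn φ (Set.Icc a b) := by
    rw [hφ]; fun_prop
  have hφmono : MonotoneOn φ (Set.Icc a b) := fun u hu v hv huv =>
    mul_le_mul_of_nonneg_right (sub_le_sub_right (hmono u v hu.1 huv hv.2) _) (by positivity)
  have hφa : φ a = 0 := by simp [hφ]
  have hφb : φ b = L := by
    change A * (L / A) = L
    field_simp
  have hφim : φ '' Set.Icc a b = Set.Icc 0 L := by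
    have := hφcont.image_Icc_of_monotoneOn hab hφmono
    rwa [hφa, hφb] at this
  have hfst : ∀ u, (γ u).1 = (γ a).1 + A / L * φ u := by
    intro u
    simp only [hφ]
    field_simp
    ring
  have hfib : ∀ u v, a ≤ u → u ≤ v → v ≤ b → φ u = φ v → γ u = γ v := by
    intro u v hu huv hv h
    have h₁ : (γ u).1 = (γ v).1 := by rw [hfst u, hfst v, h]
    refine Prod.ext h₁ (dist_eq_zero.1 ?_)
    rw [hdist u v hu huv hv, h₁, sub_self, zero_mul]
  have hpre : ∀ s ∈ Set.Icc 0 L, ∃ u ∈ Set.Icc a b, φ u = s := fun s hs => by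
    rwa [← hφim] at hs
  choose! ψ hψ hφψ using hpre
  have hspeed : √((A / L) ^ 2 - 1) = D / L := by
    rw [show (A / L) ^ 2 - 1 = (D / L) ^ 2 by field_simp; linarith]
    exact Real.sqrt_sq (by positivity)
  have hfstψ : ∀ s ∈ Set.Icc 0 L, (γ (ψ s)).1 = (γ a).1 + A / L * s := fun s hs => by
    rw [hfst, hφψ s hs]
  have hdistψ : ∀ u v, 0 ≤ u → u ≤ v → v ≤ L →
      dist (γ (ψ u)).2 (γ (ψ v)).2 = D / L * (v - u) := by
    intro u v hu huv hv
    have hu' : u ∈ Set.Icc 0 L := ⟨hu, huv.trans hv⟩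
    have hv' : v ∈ Set.Icc 0 L := ⟨hu.trans huv, hv⟩
    have key : dist (γ (ψ u)).2 (γ (ψ v)).2 = ((γ (ψ v)).1 - (γ (ψ u)).1) * (D / A) := by
      rcases le_total (ψ u) (ψ v) with h | h
      · exact hdist _ _ (hψ u hu').1 h (hψ v hv').2
      · have h' := hφmono (hψ v hv') (hψ u hu') h
        rw [hφψ u hu', hφψ v hv'] at h'
        obtain rfl : u = v := le_antisymm huv h'
        simp
    rw [key, hfstψ u hu', hfstψ v hv']
    field_simp
    ring
  refine ⟨A / L, (one_le_div htimelike).2 hLA, fun s => γ (ψ s), φ, hφcont, hφmono, hφim, ?_,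
    hfstψ, ?_, ?_, ?_⟩
  · intro u hu
    have hs : φ u ∈ Set.Icc 0 L := hφim ▸ Set.mem_image_of_mem φ hu
    rcases le_total u (ψ (φ u)) with h | h
    · exact hfib _ _ hu.1 h (hψ _ hs).2 (hφψ _ hs).symm
    · exact (hfib _ _ (hψ _ hs).1 h hu.2 (hφψ _ hs)).symm
  · intro u v hu huv hv
    rw [hspeed, hdistψ u v hu huv hv]
  · intro u v hu huv hv
    have hsub : (γ (ψ v)).1 - (γ (ψ u)).1 = A / L * (v - u) := by
      rw [hfstψ u ⟨hu, huv.trans hv⟩, hfstψ v ⟨hu.trans huv, hv⟩]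
      ring
    have hc : LorCausal (γ (ψ u)) (γ (ψ v)) := by
      rw [LorCausal, hdistψ u v hu huv hv, hsub]
      have := sub_nonneg.2 huv
      gcongr
    rw [hc.lorTau_eq, hdistψ u v hu huv hv, hsub,
      show (A / L * (v - u)) ^ 2 - (D / L * (v - u)) ^ 2 = (v - u) ^ 2 by
        field_simp
        linear_combination -(v - u) ^ 2 * hL2]
    exact Real.sqrt_sq (sub_nonneg.2 huv)
  · refine ⟨(A / L).toNNReal, LipschitzOnWith.of_dist_le_mul ?_⟩
    have hle : ∀ u v, 0 ≤ u → u ≤ v → v ≤ L →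
        dist (γ (ψ u)) (γ (ψ v)) ≤ A / L * dist u v := by
      intro u v hu huv hv
      have huv' := sub_nonneg.2 huv
      rw [Prod.dist_eq, hdistψ u v hu huv hv, hfstψ u ⟨hu, huv.trans hv⟩,
        hfstψ v ⟨hu.trans huv, hv⟩, dist_comm u v, Real.dist_eq v u, abs_of_nonneg huv']
      refine max_le ?_ (by gcongr)
      rw [dist_comm, Real.dist_eq, add_sub_add_left_eq_sub, ← mul_sub, abs_of_nonneg]
      positivity
    intro u hu v hv
    rw [Real.coe_toNNReal _ (by positivity)]
    rcases le_total u v with h | h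
    · exact hle u v hu.1 h hv.2
    · rw [dist_comm, dist_comm u v]
      exact hle v u hv.1 h hu.2
end

section
/- Let (X,d) be a metric space. Then (X,d) is proper (all closed balls are compact) if and only if for all p, q ∈ ℝ × X with p ≤ q the causal diamond J(p,q) = {r ∈ ℝ × X : p ≤ r ≤ q} of the Lorentzian product is compact. (Equivalently, the Lorentzian product ℝ × X is globally hyperbolic if and only if X is proper, since it is always non-totally imprisoning.) -/
/-!
Statement 8: A metric space `(X,d)` is proper (all closed balls are compact)
iff all causal diamonds `J(p,q)` of the Lorentzian product `ℝ × X` are compact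
(equivalently, since the product is always non-totally imprisoning, iff the
Lorentzian product is globally hyperbolic).  Note that the topology induced by
the metric `D((s,x),(t,y)) = √((t-s)² + d(x,y)²)` coincides with the product
topology on `ℝ × X`.
-/

variable {X : Type*} [MetricSpace X]

theorem lorentzian_product_globally_hyperbolic_iff_proper
    (X : Type*) [MetricSpace X] :
    (∀ (x : X) (R : ℝ), IsCompact (Metric.closedBall x R)) ↔
      (∀ p q : ℝ × X, LorCausal p q →
        IsCompact {r : ℝ × X | LorCausal p r ∧ LorCausal r q}) := by
  constructor
  · intro h p q _
    refine ((isCompact_Icc (a := p.1) (b := q.1)).prod (h p.2 (q.1 - p.1))).of_isClosed_subset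
      ?_ ?_
    · simp only [LorCausal, Set.ofPred_and]
      exact IsClosed.inter (isClosed_le (by fun_prop) (by fun_prop))
        (isClosed_le (by fun_prop) (by fun_prop))
    · rintro r ⟨h₁, h₂⟩
      simp only [LorCausal] at h₁ h₂
      have h₃ := dist_nonneg (x := p.2) (y := r.2)
      have h₄ := dist_nonneg (x := r.2) (y := q.2)
      refine ⟨⟨by linarith, by linarith⟩, ?_⟩
      rw [Metric.mem_closedBall, dist_comm]
      linarith
  · intro h x R
    rcases lt_or_ge R 0 with hR | hR
    · simp [Metric.closedBall_eq_empty.2 hR]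
    · have hd := h (-R, x) (R, x) (by simp only [LorCausal, dist_self]; linarith)
      convert hd.image continuous_snd using 1
      ext y
      simp only [LorCausal, Metric.mem_closedBall, Set.mem_image, Set.mem_ofPred_eq]
      constructor
      · intro hy
        refine ⟨(0, y), ⟨?_, ?_⟩, rfl⟩
        · rw [dist_comm]
          simpa using hy
        · simpa using hy
      · rintro ⟨r, ⟨h₁, h₂⟩, rfl⟩
        rw [dist_comm] at h₁
        linarith
end

section
/- (Verticality in Minkowski space.) Let b = (t_b, x_b) ∈ ℝ² with t_b > |x_b| (so that (0,0) ≪ b in ℝ^{1,1}). Let c_n = (t_n, x_n) be a sequence in ℝ² such that: b ≪ c_n for all n; t_n → ∞; x_b·(t_b·x_n − x_b·t_n) ≤ 0 for all n (i.e. each c_n lies on the same closed side of the straight line through (0,0) and b as the point (1,0)); and τ̄((0,0),c_n) − τ̄(b,c_n) → t_b as n → ∞. Then x_n/t_n → 0. -/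
/-!
Statement 10: Verticality in Minkowski space `ℝ^{1,1}`.  If `(0,0) ≪ b`,
`b ≪ cₙ`, `t(cₙ) → ∞`, the `cₙ` lie on the same closed side of the line
through `(0,0)` and `b` as `(1,0)`, and `τ̄((0,0),cₙ) - τ̄(b,cₙ) → t_b`, then
`x(cₙ)/t(cₙ) → 0`.
-/

/-- Timelike relation of two-dimensional Minkowski space `ℝ^{1,1}`. -/
def MinkChron (p q : ℝ × ℝ) : Prop := |q.2 - p.2| < q.1 - p.1

/-- Time separation of two-dimensional Minkowski space `ℝ^{1,1}`. -/
noncomputable def MinkTau (p q : ℝ × ℝ) : ℝ :=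
  if |q.2 - p.2| ≤ q.1 - p.1 then Real.sqrt ((q.1 - p.1) ^ 2 - (q.2 - p.2) ^ 2) else 0

theorem abs_lt_of_minkChron {tb xb t x : ℝ} (hb : |xb| < tb)
    (hc : MinkChron (tb, xb) (t, x)) : |x| < t := by
  have hc' : |x - xb| < t - tb := hc
  have := abs_add_le (x - xb) xb
  rw [sub_add_cancel] at this
  linarith

theorem minkTau_origin_sub_identity {tb xb t x : ℝ} (hb : |xb| < tb)
    (hc : MinkChron (tb, xb) (t, x)) :
    tb - x / t * xb - tb * √(1 - (x / t) ^ 2) =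
      (MinkTau (0, 0) (t, x) - MinkTau (tb, xb) (t, x) - tb) * √(1 - (x / t) ^ 2) +
        ((tb ^ 2 - xb ^ 2) - (MinkTau (0, 0) (t, x) - MinkTau (tb, xb) (t, x)) ^ 2) / (2 * t) := by
  have hc' : |x - xb| < t - tb := hc
  have hx : |x| < t := abs_lt_of_minkChron hb hc
  have ht : 0 < t := (abs_nonneg x).trans_lt hx
  have h₀ : MinkTau (0, 0) (t, x) = √(t ^ 2 - x ^ 2) := by simp [MinkTau, hx.le]
  have h₁ : MinkTau (tb, xb) (t, x) = √((t - tb) ^ 2 - (x - xb) ^ 2) := by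
    simp [MinkTau, hc'.le]
  have hs : √(t ^ 2 - x ^ 2) = t * √(1 - (x / t) ^ 2) := by
    rw [show t ^ 2 - x ^ 2 = t ^ 2 * (1 - (x / t) ^ 2) by field_simp,
      Real.sqrt_mul (sq_nonneg t), Real.sqrt_sq ht.le]
  have hsq₀ := Real.sq_sqrt (sub_nonneg.2 (sq_le_sq.2 (hx.le.trans (le_abs_self t))))
  have hsq₁ := Real.sq_sqrt (sub_nonneg.2 (sq_le_sq.2 (hc'.le.trans (le_abs_self (t - tb)))))
  rw [h₀, h₁]
  rw [hs] at hsq₀ ⊢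
  generalize √(1 - (x / t) ^ 2) = T at *
  generalize √((t - tb) ^ 2 - (x - xb) ^ 2) = S at *
  field_simp
  linear_combination hsq₁ - hsq₀

/-- On the side of the line through the origin and `b` containing `(1, 0)`, the square of the
slope is controlled by the defect in the equation `tb - v * xb = tb * √(1 - v ^ 2)`. -/
theorem sq_slope_le_defect {tb xb v : ℝ} (hb : |xb| < tb) (hv : |v| ≤ 1)
    (hside : xb * (tb * v - xb) ≤ 0) :
    (tb ^ 2 - xb ^ 2) * v ^ 2 ≤ 3 * tb * |tb - v * xb - tb * √(1 - v ^ 2)| := by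
  have htb : 0 < tb := (abs_nonneg xb).trans_lt hb
  have hsq : √(1 - v ^ 2) ^ 2 = 1 - v ^ 2 :=
    Real.sq_sqrt (sub_nonneg.2 ((sq_le_one_iff_abs_le_one v).2 hv))
  have hT₀ := Real.sqrt_nonneg (1 - v ^ 2)
  have hT₁ : √(1 - v ^ 2) ≤ 1 := Real.sqrt_le_one.2 (by nlinarith [sq_nonneg v])
  have hvx : |v * xb| ≤ tb := by
    rw [abs_mul]
    nlinarith [abs_nonneg xb]
  have hw : |v * (2 * tb * xb - v * (tb ^ 2 + xb ^ 2))| ≤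
      3 * tb * |tb - v * xb - tb * √(1 - v ^ 2)| := by
    rw [show v * (2 * tb * xb - v * (tb ^ 2 + xb ^ 2)) =
      -((tb * √(1 - v ^ 2) + tb - v * xb) * (tb - v * xb - tb * √(1 - v ^ 2))) by
        linear_combination -tb ^ 2 * hsq, abs_neg, abs_mul]
    gcongr
    rw [abs_le] at hvx ⊢
    constructor <;> nlinarith
  refine le_trans ?_ hw
  rcases le_or_gt (v * xb) 0 with h | h
  · refine le_trans ?_ (neg_le_abs _)
    nlinarith [mul_nonneg htb.le (neg_nonneg.2 h), mul_nonneg (sq_nonneg xb) (sq_nonneg v)]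
  · refine le_trans ?_ (le_abs_self _)
    have hxb : 0 < xb ^ 2 := by
      have : xb ≠ 0 := by rintro rfl; simp at h
      positivity
    have hv2 : tb * v ^ 2 ≤ v * xb := by
      refine le_of_mul_le_mul_right ?_ hxb
      nlinarith [mul_nonneg h.le (neg_nonneg.2 hside)]
    nlinarith [mul_le_mul_of_nonneg_left hv2 htb.le]

theorem verticality_in_minkowski (tb xb : ℝ) (hb : |xb| < tb)
    (t x : ℕ → ℝ)
    (hchron : ∀ n, MinkChron (tb, xb) (t n, x n))
    (ht : Filter.Tendsto t Filter.atTop Filter.atTop)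
    (hside : ∀ n, xb * (tb * x n - xb * t n) ≤ 0)
    (htau : Filter.Tendsto
      (fun n => MinkTau (0, 0) (t n, x n) - MinkTau (tb, xb) (t n, x n))
      Filter.atTop (nhds tb)) :
    Filter.Tendsto (fun n => x n / t n) Filter.atTop (nhds 0) := by
  have hk : 0 < tb ^ 2 - xb ^ 2 := sub_pos.2 (sq_lt_sq.2 (hb.trans_le (le_abs_self tb)))
  have hx (n : ℕ) : |x n| < t n := abs_lt_of_minkChron hb (hchron n)
  have htpos (n : ℕ) : 0 < t n := (abs_nonneg _).trans_lt (hx n)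
  have hv (n : ℕ) : |x n / t n| ≤ 1 := by
    rw [abs_div, abs_of_pos (htpos n)]
    exact (div_le_one (htpos n)).2 (hx n).le
  have hT : Filter.Tendsto
      (fun n => (MinkTau (0, 0) (t n, x n) - MinkTau (tb, xb) (t n, x n) - tb) *
        √(1 - (x n / t n) ^ 2)) Filter.atTop (nhds 0) := by
    refine squeeze_zero_norm (fun n => ?_)
      (tendsto_zero_iff_norm_tendsto_zero.1 (tendsto_sub_nhds_zero_iff.2 htau))
    rw [norm_mul, Real.norm_of_nonneg (Real.sqrt_nonneg _)]
    exact mul_le_of_le_one_right (norm_nonneg _)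
      (Real.sqrt_le_one.2 (by nlinarith [sq_nonneg (x n / t n)]))
  have hdefect : Filter.Tendsto
      (fun n => tb - x n / t n * xb - tb * √(1 - (x n / t n) ^ 2)) Filter.atTop (nhds 0) := by
    simp_rw [fun n => minkTau_origin_sub_identity hb (hchron n)]
    simpa using hT.add
      (((htau.pow 2).const_sub (tb ^ 2 - xb ^ 2)).div_atTop (ht.const_mul_atTop two_pos))
  have hsq : Filter.Tendsto (fun n => (tb ^ 2 - xb ^ 2) * (x n / t n) ^ 2)
      Filter.atTop (nhds 0) := by
    refine squeeze_zero (fun n => by positivity) (fun n => sq_slope_le_defect hb (hv n) ?_)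
      (by simpa using hdefect.abs.const_mul (3 * tb))
    rw [show xb * (tb * (x n / t n) - xb) = xb * (tb * x n - xb * t n) / t n by
      have := (htpos n).ne'
      field_simp]
    exact div_nonpos_of_nonpos_of_nonneg (hside n) (htpos n).le
  have hsq' : Filter.Tendsto (fun n => (x n / t n) ^ 2) Filter.atTop (nhds 0) := by
    have := (hsq.div_const (tb ^ 2 - xb ^ 2)).congr fun n => mul_div_cancel_left₀ _ hk.ne'
    rwa [zero_div] at this
  exact (tendsto_zero_iff_abs_tendsto_zero _).2 (by simpa [Function.comp_def, Real.sqrt_sq_eq_abs] using hsq'.sqrt)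
end

section
/- Let X be a topological space and ≪ a transitive relation on X. For x, y ∈ X write I(x,y) = {z ∈ X : x ≪ z ≪ y}. Assume: (a) the family {I(x,y) : x, y ∈ X} is a subbasis for the topology of X (i.e. finite intersections of such sets form a basis); and (b) for each x ∈ X there exist ε > 0 and a continuous map γ : [−ε,ε] → X with γ(0) = x and γ(s) ≪ γ(t) whenever −ε ≤ s < t ≤ ε. Then {I(x,y) : x, y ∈ X} is itself a basis for the topology of X. Moreover, for each x ∈ X, each continuous γ : [−ε,ε] → X with γ(0) = x and γ(s) ≪ γ(t) for s < t, and all sequences of positive reals s_n → 0 and t_n → 0, the family {I(γ(−s_n),γ(t_n)) : n ∈ ℕ} is a neighbourhood basis at x. -/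
/-!
Statement 12: In a topological space `X` with a transitive relation `≪` whose
timelike diamonds `I(x,y) = {z : x ≪ z ≪ y}` form a subbasis of the topology
(i.e. the topology is generated by them), and in which every point lies in the
interior of a timelike curve, the diamonds themselves form a basis of the
topology; moreover, along any timelike curve through `x` and any positive
null sequences `sₙ, tₙ → 0`, the diamonds `I(γ(-sₙ), γ(tₙ))` form a
neighbourhood basis at `x`.
-/

open Filter Topology

/-- If the diamonds of a transitive relation generate the topology, then diamonds whose endpoints
converge to `x` are eventually contained in every open set around `x`. -/
theorem eventually_diamond_subset_of_tendsto {X ι : Type*} [T : TopologicalSpace X]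
    {ll : X → X → Prop} (h_trans : ∀ x y z : X, ll x y → ll y z → ll x z)
    (h_subbasis : T = TopologicalSpace.generateFrom
      {S : Set X | ∃ x y : X, S = {z : X | ll x z ∧ ll z y}})
    {l : Filter ι} {a b : ι → X} {x : X} (ha : Tendsto a l (𝓝 x)) (hb : Tendsto b l (𝓝 x))
    {U : Set X} (hU : IsOpen U) (hx : x ∈ U) :
    ∀ᶠ i in l, {z : X | ll (a i) z ∧ ll z (b i)} ⊆ U := by
  have hgen : TopologicalSpace.GenerateOpen
      {S : Set X | ∃ x y : X, S = {z : X | ll x z ∧ ll z y}} U := by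
    rw [h_subbasis] at hU
    exact hU
  clear hU
  induction hgen with
  | basic S hS =>
    have hopen : IsOpen S := by
      rw [h_subbasis]
      exact TopologicalSpace.isOpen_generateFrom_of_mem hS
    obtain ⟨p, q, rfl⟩ := hS
    filter_upwards [ha (hopen.mem_nhds hx), hb (hopen.mem_nhds hx)] with i hai hbi z hz
    exact ⟨h_trans _ _ _ hai.1 hz.1, h_trans _ _ _ hz.2 hbi.2⟩
  | univ => simp
  | inter S R _ _ ihS ihR =>
    filter_upwards [ihS hx.1, ihR hx.2] with i hS hR
    exact Set.subset_inter hS hR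
  | sUnion C _ ih =>
    obtain ⟨S, hSC, hxS⟩ := hx
    filter_upwards [ih S hSC hxS] with i hi
    exact hi.trans (Set.subset_sUnion_of_mem hSC)

theorem timelike_diamonds_form_basis
    (X : Type*) [TopologicalSpace X] (ll : X → X → Prop)
    (h_trans : ∀ x y z : X, ll x y → ll y z → ll x z)
    -- (a) the diamonds are a subbasis for the topology of X
    (h_subbasis : (inferInstance : TopologicalSpace X) =
      TopologicalSpace.generateFrom
        {S : Set X | ∃ x y : X, S = {z : X | ll x z ∧ ll z y}})
    -- (b) every point lies in the interior of a timelike curve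
    (h_curve : ∀ x : X, ∃ ε : ℝ, 0 < ε ∧ ∃ γ : ℝ → X,
      ContinuousOn γ (Set.Icc (-ε) ε) ∧ γ 0 = x ∧
      ∀ s t : ℝ, -ε ≤ s → s < t → t ≤ ε → ll (γ s) (γ t)) :
    -- the diamonds form a basis of the topology
    TopologicalSpace.IsTopologicalBasis
      {S : Set X | ∃ x y : X, S = {z : X | ll x z ∧ ll z y}} ∧
    -- and the diamonds along a timelike curve form a neighbourhood basis
    (∀ (x : X) (ε : ℝ) (γ : ℝ → X), 0 < ε →
      ContinuousOn γ (Set.Icc (-ε) ε) → γ 0 = x →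
      (∀ s t : ℝ, -ε ≤ s → s < t → t ≤ ε → ll (γ s) (γ t)) →
      ∀ s t : ℕ → ℝ, (∀ n, 0 < s n ∧ s n ≤ ε) → (∀ n, 0 < t n ∧ t n ≤ ε) →
        Tendsto s atTop (𝓝 0) → Tendsto t atTop (𝓝 0) →
        (𝓝 x).HasBasis (fun _ : ℕ => True)
          (fun n => {z : X | ll (γ (-(s n))) z ∧ ll z (γ (t n))})) := by
  unfold inferInstance at h_subbasis
  have hopen (p q : X) : IsOpen {z : X | ll p z ∧ ll z q} := by
    rw [h_subbasis]
    exact TopologicalSpace.isOpen_generateFrom_of_mem ⟨p, q, rfl⟩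
  have hnhds : ∀ (x : X) (ε : ℝ) (γ : ℝ → X), 0 < ε →
      ContinuousOn γ (Set.Icc (-ε) ε) → γ 0 = x →
      (∀ s t : ℝ, -ε ≤ s → s < t → t ≤ ε → ll (γ s) (γ t)) →
      ∀ s t : ℕ → ℝ, (∀ n, 0 < s n ∧ s n ≤ ε) → (∀ n, 0 < t n ∧ t n ≤ ε) →
        Tendsto s atTop (𝓝 0) → Tendsto t atTop (𝓝 0) →
        (𝓝 x).HasBasis (fun _ : ℕ => True)
          (fun n => {z : X | ll (γ (-(s n))) z ∧ ll z (γ (t n))}) := by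
    rintro x ε γ hε hγ rfl hll s t hs ht hs0 ht0
    have hγ0 : Tendsto γ (𝓝 0) (𝓝 (γ 0)) :=
      hγ.continuousAt (Icc_mem_nhds (neg_lt_zero.mpr hε) hε)
    have ha : Tendsto (fun n => γ (-(s n))) atTop (𝓝 (γ 0)) :=
      hγ0.comp (by simpa using hs0.neg)
    have hb : Tendsto (fun n => γ (t n)) atTop (𝓝 (γ 0)) := hγ0.comp ht0
    refine ⟨fun U => ⟨fun hU => ?_, ?_⟩⟩
    · obtain ⟨V, hVU, hV, hxV⟩ := mem_nhds_iff.mp hU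
      obtain ⟨n, hn⟩ :=
        (eventually_diamond_subset_of_tendsto h_trans h_subbasis ha hb hV hxV).exists
      exact ⟨n, trivial, hn.trans hVU⟩
    · rintro ⟨n, -, hn⟩
      refine mem_of_superset ((hopen _ _).mem_nhds ⟨?_, ?_⟩) hn
      · exact hll _ _ (neg_le_neg (hs n).2) (neg_lt_zero.mpr (hs n).1) hε.le
      · exact hll _ _ (neg_nonpos.mpr hε.le) (ht n).1 (ht n).2
  refine ⟨TopologicalSpace.isTopologicalBasis_of_isOpen_of_nhds ?_ fun x U hx hU => ?_, hnhds⟩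
  · rintro _ ⟨p, q, rfl⟩
    exact hopen p q
  · obtain ⟨ε, hε, γ, hγ, hγx, hll⟩ := h_curve x
    have hr (n : ℕ) : 0 < ε / ((n : ℝ) + 1) ∧ ε / ((n : ℝ) + 1) ≤ ε :=
      ⟨by positivity, div_le_self hε.le (by simp)⟩
    have hr0 : Tendsto (fun n : ℕ => ε / ((n : ℝ) + 1)) atTop (𝓝 0) :=
      tendsto_const_nhds.div_atTop (tendsto_atTop_add_const_right _ _ tendsto_natCast_atTop_atTop)
    have hbasis := hnhds x ε γ hε hγ hγx hll _ _ hr hr hr0 hr0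
    obtain ⟨n, -, hn⟩ := hbasis.mem_iff.mp (hU.mem_nhds hx)
    exact ⟨_, ⟨_, _, rfl⟩, mem_of_mem_nhds (hbasis.mem_of_mem trivial), hn⟩
end

section
/- (The c-criterion for synchronised parallel lines.) Let (X,d,≪,≤,τ) be a Lorentzian pre-length space in which τ is continuous and τ(x,x) = 0 for all x ∈ X. Let α, β : ℝ → X be continuous timelike lines parametrised by τ-arclength, i.e. τ(α(s),α(t)) = t − s and τ(β(s),β(t)) = t − s for all s ≤ t. Fix c ≥ 0. Then the following are equivalent. (A) α and β are synchronised parallel with distance c, meaning: for all s, t ∈ ℝ, α(s) ≤ β(t) if and only if t − s ≥ c; β(t) ≤ α(s) if and only if s − t ≥ c; τ(α(s),β(t)) = sqrt((t−s)^2 − c^2) whenever t − s ≥ c; and τ(β(t),α(s)) = sqrt((s−t)^2 − c^2) whenever s − t ≥ c. (B) The following four conditions hold: (i) (t−s)^2 − τ(α(s),β(t))^2 = c^2 whenever α(s) ≤ β(t); (ii) (s−t)^2 − τ(β(t),α(s))^2 = c^2 whenever β(t) ≤ α(s); (iii) for every s ∈ ℝ the set {t − s : α(s) ≤ β(t)}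 has a minimum, equal to c; (iv) for every s ∈ ℝ the set {t − s : β(s) ≤ α(t)} has a minimum, equal to c. -/
/-!
Statement 13: The c-criterion for synchronised parallel lines.  In a Lorentzian
pre-length space with continuous `τ` and `τ(x,x) = 0`, two `τ`-arclength
parametrised complete timelike lines `α, β : ℝ → X` are synchronised parallel
with distance `c ≥ 0` (i.e. `α(s) ↦ (s,0)`, `β(t) ↦ (t,c)` is a `τ`- and
`≤`-preserving map into `ℝ^{1,1}` with image two parallel vertical lines)
if and only if the four `c`-functions are constant `= c` and the infima are
minima.
-/

/-- A curve parametrised by `τ`-arclength is monotone for the causal relation. -/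
theorem causal_of_arclength {X : Type*} {le ll : X → X → Prop} {tau : X → X → ℝ}
    (h_le_refl : ∀ x, le x x) (h_ll_le : ∀ x y, ll x y → le x y)
    (h_tau_pos : ∀ x y, 0 < tau x y ↔ ll x y) {γ : ℝ → X}
    (hγ : ∀ s t : ℝ, s ≤ t → tau (γ s) (γ t) = t - s) {s t : ℝ} (hst : s ≤ t) :
    le (γ s) (γ t) := by
  rcases hst.eq_or_lt with rfl | h
  · exact h_le_refl _
  · exact h_ll_le _ _ ((h_tau_pos _ _).1 (by rw [hγ s t hst]; linarith))

/-- If `c` is the least delay after which `γ s` precedes `δ`, and `δ` is causally monotone,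
then `γ s` precedes exactly the points of `δ` with delay at least `c`. -/
theorem causal_iff_of_isLeast {X : Type*} {le : X → X → Prop}
    (h_le_trans : ∀ x y z, le x y → le y z → le x z) {γ δ : ℝ → X}
    (hδ : ∀ s t : ℝ, s ≤ t → le (δ s) (δ t)) {c : ℝ}
    (h : ∀ s : ℝ, IsLeast {d : ℝ | le (γ s) (δ (s + d))} c) (s t : ℝ) :
    le (γ s) (δ t) ↔ c ≤ t - s := by
  constructor
  · intro hle
    exact (h s).2 (by simpa using hle)
  · intro hct
    exact h_le_trans _ _ _ (h s).1 (hδ _ _ (by linarith))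

theorem c_criterion_for_parallel_lines
    (X : Type*) [MetricSpace X]
    (le ll : X → X → Prop) (tau : X → X → ℝ)
    -- Lorentzian pre-length space axioms
    (h_le_refl : ∀ x, le x x)
    (h_le_trans : ∀ x y z, le x y → le y z → le x z)
    (h_ll_trans : ∀ x y z, ll x y → ll y z → ll x z)
    (h_ll_le : ∀ x y, ll x y → le x y)
    (h_tau_nonneg : ∀ x y, 0 ≤ tau x y)
    (h_tau_zero : ∀ x y, ¬ le x y → tau x y = 0)
    (h_tau_pos : ∀ x y, 0 < tau x y ↔ ll x y)
    (h_rev_tri : ∀ x y z, le x y → le y z → tau x y + tau y z ≤ tau x z)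
    -- τ is continuous and vanishes on the diagonal
    (h_tau_cont : Continuous (fun p : X × X => tau p.1 p.2))
    (h_tau_refl : ∀ x, tau x x = 0)
    -- α, β are τ-arclength parametrised timelike lines
    (α β : ℝ → X)
    (hα_cont : Continuous α) (hβ_cont : Continuous β)
    (hα : ∀ s t : ℝ, s ≤ t → tau (α s) (α t) = t - s)
    (hβ : ∀ s t : ℝ, s ≤ t → tau (β s) (β t) = t - s)
    (c : ℝ) (hc : 0 ≤ c) :
    -- (A) α and β are synchronised parallel with distance c
    (((∀ s t : ℝ, le (α s) (β t) ↔ c ≤ t - s) ∧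
      (∀ s t : ℝ, le (β t) (α s) ↔ c ≤ s - t) ∧
      (∀ s t : ℝ, c ≤ t - s → tau (α s) (β t) = Real.sqrt ((t - s) ^ 2 - c ^ 2)) ∧
      (∀ s t : ℝ, c ≤ s - t → tau (β t) (α s) = Real.sqrt ((s - t) ^ 2 - c ^ 2)))
    ↔
    -- (B) the c-functions are constant = c and the infima are minima
    ((∀ s t : ℝ, le (α s) (β t) → (t - s) ^ 2 - tau (α s) (β t) ^ 2 = c ^ 2) ∧
      (∀ s t : ℝ, le (β t) (α s) → (s - t) ^ 2 - tau (β t) (α s) ^ 2 = c ^ 2) ∧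
      (∀ s : ℝ, IsLeast {d : ℝ | le (α s) (β (s + d))} c) ∧
      (∀ s : ℝ, IsLeast {d : ℝ | le (β s) (α (s + d))} c))) := by
  constructor
  · rintro ⟨hαβ, hβα, hταβ, hτβα⟩
    refine ⟨fun s t h => ?_, fun s t h => ?_, fun s => ⟨?_, fun d hd => ?_⟩,
      fun s => ⟨?_, fun d hd => ?_⟩⟩
    · have hct := (hαβ s t).1 h
      rw [hταβ s t hct, Real.sq_sqrt (by nlinarith)]
      ring
    · have hct := (hβα s t).1 h
      rw [hτβα s t hct, Real.sq_sqrt (by nlinarith)]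
      ring
    · exact (hαβ _ _).2 (by linarith)
    · have := (hαβ _ _).1 hd
      linarith
    · exact (hβα _ _).2 (by linarith)
    · have := (hβα _ _).1 hd
      linarith
  · rintro ⟨hταβ, hτβα, hmαβ, hmβα⟩
    have hαβ := causal_iff_of_isLeast h_le_trans
      (fun _ _ => causal_of_arclength h_le_refl h_ll_le h_tau_pos hβ) hmαβ
    have hβα := causal_iff_of_isLeast h_le_trans
      (fun _ _ => causal_of_arclength h_le_refl h_ll_le h_tau_pos hα) hmβα
    refine ⟨hαβ, fun s t => hβα t s, fun s t h => ?_, fun s t h => ?_⟩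
    · rw [← hταβ s t ((hαβ s t).2 h), sub_sub_cancel, Real.sqrt_sq (h_tau_nonneg _ _)]
    · rw [← hτβα s t ((hβα t s).2 h), sub_sub_cancel, Real.sqrt_sq (h_tau_nonneg _ _)]
end

section
/- (The strong causality trick.) Let (X,d,≪,≤,τ) be a Lorentzian pre-length space in which τ is continuous, τ(x,x) = 0 for all x ∈ X, and which is strongly causal in the sense that the family of timelike diamonds I(p,q) = {z ∈ X : p ≪ z ≪ q} (p,q ∈ X) is a subbasis for the metric topology of (X,d). Let b > 0 and let α, β : [0,b) → X be continuous curves with α(0) = β(0) and τ(α(s),α(t)) = t − s and τ(β(s),β(t)) = t − s for all 0 ≤ s ≤ t < b (i.e. α and β are τ-arclength parametrised timelike distance realisers issuing from a common point). Assume that for all s, t ∈ (0,b): if α(s) ≪ β(t) then τ(α(s),β(t)) = |t − s|, and if β(t) ≪ α(s) then τ(β(t),α(s)) = |s − t| (i.e. all comparison angles between α and β at the common starting point vanish). Then α = β. -/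
/-!
Statement 14: The strong causality trick.  In a strongly causal Lorentzian
pre-length space with continuous `τ` and `τ(x,x) = 0`, two `τ`-arclength
parametrised timelike distance realisers `α, β : [0,b) → X` issuing from a
common point, all of whose mutual comparison angles at the starting point
vanish (i.e. `τ` between them equals `|t - s|` whenever they are timelike
related), coincide.
-/

/-- Points which lie in the same members of a subbasis of a `T1` topology coincide. -/
theorem eq_of_forall_mem_subbasis {X : Type*} [t : TopologicalSpace X] [T1Space X]
    {g : Set (Set X)} (ht : t = TopologicalSpace.generateFrom g) {x y : X}
    (h : ∀ S ∈ g, x ∈ S → y ∈ S) : x = y := by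
  have key : ∀ U, TopologicalSpace.GenerateOpen g U → x ∈ U → y ∈ U := by
    intro U hU
    induction hU with
    | basic S hS => exact h S hS
    | univ => exact fun _ => Set.mem_univ y
    | inter S T _ _ hS hT => exact fun hx => ⟨hS hx.1, hT hx.2⟩
    | sUnion K _ ih => exact fun ⟨S, hSK, hxS⟩ => ⟨S, hSK, ih S hSK hxS⟩
  by_contra hne
  have hopen : IsOpen ({y}ᶜ : Set X) := isOpen_compl_singleton
  subst ht
  exact key _ hopen hne rfl

/-- A continuous function on `[0, t)` that starts at `t` and takes at each positive `s` the value
`t - s` unless it is nonpositive there, is positive. -/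
theorem pos_of_eq_sub_of_pos {g : ℝ → ℝ} {t : ℝ}
    (hg : ContinuousOn g (Set.Ico 0 t)) (hg0 : g 0 = t)
    (hval : ∀ s, 0 < s → s < t → 0 < g s → g s = t - s) {s : ℝ} (hs : 0 ≤ s) (hst : s < t) :
    0 < g s := by
  by_contra! hneg
  have hcont : ContinuousOn (fun r => g r - (t - r) / 2) (Set.Icc 0 s) :=
    (hg.mono (Set.Icc_subset_Ico_right hst)).sub (by fun_prop)
  obtain ⟨r, ⟨hr0, hrs⟩, hr⟩ := intermediate_value_Icc' hs hcont
    (show (0 : ℝ) ∈ Set.Icc _ _ from ⟨by linarith, by linarith⟩)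
  simp only at hr
  rcases hr0.eq_or_lt with rfl | hr0
  · linarith
  · linarith [hval r hr0 (by linarith) (by linarith)]

/-- Two curves from a common point whose mutual time separations are either zero or the difference
of the parameters interleave chronologically. -/
theorem tau_pos_of_lt {X : Type*} [TopologicalSpace X] {tau : X → X → ℝ}
    (h_tau_cont : Continuous (fun p : X × X => tau p.1 p.2)) {b : ℝ} {α β : ℝ → X}
    (hα_cont : ContinuousOn α (Set.Ico 0 b)) (h0 : α 0 = β 0)
    (hβ : ∀ s t : ℝ, 0 ≤ s → s ≤ t → t < b → tau (β s) (β t) = t - s)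
    (hangle : ∀ s t : ℝ, 0 < s → s < b → 0 < t → t < b →
      0 < tau (α s) (β t) → tau (α s) (β t) = |t - s|)
    {s t : ℝ} (hs : 0 ≤ s) (hst : s < t) (htb : t < b) : 0 < tau (α s) (β t) := by
  refine pos_of_eq_sub_of_pos (g := fun r => tau (α r) (β t)) (t := t) ?_ ?_ ?_ hs hst
  · exact h_tau_cont.comp_continuousOn
      ((hα_cont.mono (Set.Ico_subset_Ico_right htb.le)).prodMk continuousOn_const)
  · simpa [h0] using hβ 0 t le_rfl (hs.trans hst.le) htb
  · intro r hr hrt hpos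
    have h := hangle r t hr (hrt.trans htb) (hr.trans hrt) htb hpos
    rwa [abs_of_pos (sub_pos.2 hrt)] at h

theorem strong_causality_trick
    (X : Type*) [MetricSpace X]
    (le ll : X → X → Prop) (tau : X → X → ℝ)
    -- Lorentzian pre-length space axioms
    (h_le_refl : ∀ x, le x x)
    (h_le_trans : ∀ x y z, le x y → le y z → le x z)
    (h_ll_trans : ∀ x y z, ll x y → ll y z → ll x z)
    (h_ll_le : ∀ x y, ll x y → le x y)
    (h_tau_nonneg : ∀ x y, 0 ≤ tau x y)
    (h_tau_zero : ∀ x y, ¬ le x y → tau x y = 0)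
    (h_tau_pos : ∀ x y, 0 < tau x y ↔ ll x y)
    (h_rev_tri : ∀ x y z, le x y → le y z → tau x y + tau y z ≤ tau x z)
    -- τ is continuous and vanishes on the diagonal
    (h_tau_cont : Continuous (fun p : X × X => tau p.1 p.2))
    (h_tau_refl : ∀ x, tau x x = 0)
    -- strong causality: the timelike diamonds are a subbasis of the metric
    -- topology
    (h_strongly_causal : (inferInstance : TopologicalSpace X) =
      TopologicalSpace.generateFrom
        {S : Set X | ∃ p q : X, S = {z : X | ll p z ∧ ll z q}})
    -- α, β are τ-arclength parametrised timelike distance realisers from a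
    -- common point
    (b : ℝ) (hb : 0 < b) (α β : ℝ → X)
    (hα_cont : ContinuousOn α (Set.Ico 0 b))
    (hβ_cont : ContinuousOn β (Set.Ico 0 b))
    (h0 : α 0 = β 0)
    (hα : ∀ s t : ℝ, 0 ≤ s → s ≤ t → t < b → tau (α s) (α t) = t - s)
    (hβ : ∀ s t : ℝ, 0 ≤ s → s ≤ t → t < b → tau (β s) (β t) = t - s)
    -- all comparison angles between α and β at the common starting point
    -- vanish
    (hangle₁ : ∀ s t : ℝ, 0 < s → s < b → 0 < t → t < b →
      ll (α s) (β t) → tau (α s) (β t) = |t - s|)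
    (hangle₂ : ∀ s t : ℝ, 0 < s → s < b → 0 < t → t < b →
      ll (β t) (α s) → tau (β t) (α s) = |s - t|) :
    ∀ u : ℝ, 0 ≤ u → u < b → α u = β u := by
  intro u hu hub
  rcases hu.eq_or_lt with rfl | hu
  · exact h0
  have hαβ : ∀ s t, 0 ≤ s → s < t → t < b → ll (α s) (β t) := fun s t hs hst htb =>
    (h_tau_pos _ _).1 <| tau_pos_of_lt h_tau_cont hα_cont h0 hβ
      (fun s t hs hsb ht htb h => hangle₁ s t hs hsb ht htb ((h_tau_pos _ _).1 h)) hs hst htb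
  have hβα : ∀ s t, 0 ≤ s → s < t → t < b → ll (β s) (α t) := fun s t hs hst htb =>
    (h_tau_pos _ _).1 <| tau_pos_of_lt h_tau_cont hβ_cont h0.symm hα
      (fun s t hs hsb ht htb h => hangle₂ t s ht htb hs hsb ((h_tau_pos _ _).1 h)) hs hst htb
  refine eq_of_forall_mem_subbasis h_strongly_causal ?_
  rintro _ ⟨p, q, rfl⟩ hmem
  have hopen : IsOpen {z : X | ll p z ∧ ll z q} := by
    simp only [← h_tau_pos]
    exact (isOpen_lt continuous_const (h_tau_cont.comp (.prodMk_right p))).inter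
      (isOpen_lt continuous_const (h_tau_cont.comp (.prodMk_left q)))
  have hev : ∀ᶠ r in nhds u, ll p (α r) ∧ ll (α r) q :=
    (hα_cont.continuousAt (Ico_mem_nhds hu hub)).eventually (hopen.mem_nhds hmem)
  obtain ⟨l, ⟨hlp, -⟩, hl0, hlu⟩ :=
    ((hev.filter_mono nhdsWithin_le_nhds).and (Ioo_mem_nhdsLT hu)).exists
  obtain ⟨r, ⟨-, hrq⟩, hur, hrb⟩ :=
    ((hev.filter_mono nhdsWithin_le_nhds).and (Ioo_mem_nhdsGT hub)).exists
  exact ⟨h_ll_trans _ _ _ hlp (hαβ l u hl0.le hlu hub),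
    h_ll_trans _ _ _ (hβα u r hu.le hur hrb) hrq⟩
end

section
/- (Numerical core of the Alexandrov lemma, future version, in the Minkowski plane.) For all positive real numbers a₁, a₂, b₁, b₂, b₃ satisfying b₂ ≥ a₂ + b₃ and b₁ ≥ a₁ + b₂, one has arcosh((b₁² + b₂² − a₁²)/(2·b₁·b₂)) + arcosh((b₂² + b₃² − a₂²)/(2·b₂·b₃)) ≤ arcosh((b₁² + b₃² − (a₁+a₂)²)/(2·b₁·b₃)). (All three arguments of arcosh are ≥ 1 under these hypotheses.) -/
/-!
Statement 15: Numerical core of the Alexandrov lemma (future version) in the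
Minkowski plane: for positive reals `a₁, a₂, b₁, b₂, b₃` with `b₂ ≥ a₂ + b₃`
and `b₁ ≥ a₁ + b₂`,
`arcosh((b₁² + b₂² - a₁²)/(2b₁b₂)) + arcosh((b₂² + b₃² - a₂²)/(2b₂b₃))
  ≤ arcosh((b₁² + b₃² - (a₁+a₂)²)/(2b₁b₃))`.
-/

/-- The inverse hyperbolic cosine, `arcosh x = log (x + √(x² - 1))`. -/
noncomputable def arcosh (x : ℝ) : ℝ := Real.log (x + Real.sqrt (x ^ 2 - 1))

theorem arcosh_eq_real_arcosh (x : ℝ) : arcosh x = Real.arcosh x := rfl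

theorem arcosh_add_le_of_mul_add_sqrt_mul_sqrt_le {A B C : ℝ} (hA : 1 ≤ A) (hB : 1 ≤ B)
    (h : A * B + Real.sqrt (A ^ 2 - 1) * Real.sqrt (B ^ 2 - 1) ≤ C) :
    arcosh A + arcosh B ≤ arcosh C := by
  simp only [arcosh_eq_real_arcosh]
  have hpos : 0 < A * B + Real.sqrt (A ^ 2 - 1) * Real.sqrt (B ^ 2 - 1) := by positivity
  have hcosh : Real.cosh (Real.arcosh A + Real.arcosh B) =
      A * B + Real.sqrt (A ^ 2 - 1) * Real.sqrt (B ^ 2 - 1) := by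
    rw [Real.cosh_add, Real.cosh_arcosh hA, Real.cosh_arcosh hB, Real.sinh_arcosh hA,
      Real.sinh_arcosh hB]
  rw [← Real.arcosh_cosh (add_nonneg (Real.arcosh_nonneg hA) (Real.arcosh_nonneg hB)), hcosh]
  exact (Real.arcosh_le_arcosh hpos (hpos.trans_le h)).2 h

/-- The reverse Cauchy-Schwarz inequality for future causal vectors in the Minkowski plane. -/
theorem mul_add_mul_le_of_sq_sub_sq_eq {u₀ u₁ v₀ v₁ a b : ℝ} (hu₀ : 0 ≤ u₀) (hv₀ : 0 ≤ v₀)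
    (hu : u₀ ^ 2 - u₁ ^ 2 = a ^ 2) (hv : v₀ ^ 2 - v₁ ^ 2 = b ^ 2) :
    a * b + u₁ * v₁ ≤ u₀ * v₀ := by
  refine le_of_sq_le_sq ?_ (mul_nonneg hu₀ hv₀)
  have hu' : u₀ ^ 2 = a ^ 2 + u₁ ^ 2 := by linarith
  have hv' : v₀ ^ 2 = b ^ 2 + v₁ ^ 2 := by linarith
  rw [mul_pow, hu', hv']
  nlinarith [sq_nonneg (a * v₁ - b * u₁)]

theorem one_le_cosine_ratio {a b c : ℝ} (ha : 0 < a) (hb : 0 < b) (hc : 0 < c)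
    (h : a + c ≤ b) : 1 ≤ (b ^ 2 + c ^ 2 - a ^ 2) / (2 * b * c) := by
  rw [le_div_iff₀ (by positivity)]
  nlinarith

theorem alexandrov_lemma_future_split_angle
    (a₁ a₂ b₁ b₂ b₃ : ℝ)
    (ha₁ : 0 < a₁) (ha₂ : 0 < a₂) (hb₁ : 0 < b₁) (hb₂ : 0 < b₂) (hb₃ : 0 < b₃)
    (h₂ : a₂ + b₃ ≤ b₂) (h₁ : a₁ + b₂ ≤ b₁) :
    arcosh ((b₁ ^ 2 + b₂ ^ 2 - a₁ ^ 2) / (2 * b₁ * b₂)) +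
      arcosh ((b₂ ^ 2 + b₃ ^ 2 - a₂ ^ 2) / (2 * b₂ * b₃)) ≤
    arcosh ((b₁ ^ 2 + b₃ ^ 2 - (a₁ + a₂) ^ 2) / (2 * b₁ * b₃)) := by
  have hA := one_le_cosine_ratio ha₁ hb₁ hb₂ h₁
  have hB := one_le_cosine_ratio ha₂ hb₂ hb₃ h₂
  refine arcosh_add_le_of_mul_add_sqrt_mul_sqrt_le hA hB ?_
  rw [le_div_iff₀ (by positivity)]
  have eA : 2 * b₁ * b₂ * ((b₁ ^ 2 + b₂ ^ 2 - a₁ ^ 2) / (2 * b₁ * b₂)) =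
      b₁ ^ 2 + b₂ ^ 2 - a₁ ^ 2 := by field_simp
  have eB : 2 * b₂ * b₃ * ((b₂ ^ 2 + b₃ ^ 2 - a₂ ^ 2) / (2 * b₂ * b₃)) =
      b₂ ^ 2 + b₃ ^ 2 - a₂ ^ 2 := by field_simp
  generalize (b₁ ^ 2 + b₂ ^ 2 - a₁ ^ 2) / (2 * b₁ * b₂) = A at *
  generalize (b₂ ^ 2 + b₃ ^ 2 - a₂ ^ 2) / (2 * b₂ * b₃) = B at *
  have hs : Real.sqrt (A ^ 2 - 1) ^ 2 = A ^ 2 - 1 := Real.sq_sqrt (by nlinarith)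
  have ht : Real.sqrt (B ^ 2 - 1) ^ 2 = B ^ 2 - 1 := Real.sq_sqrt (by nlinarith)
  generalize Real.sqrt (A ^ 2 - 1) = s at *
  generalize Real.sqrt (B ^ 2 - 1) = t at *
  have hu₀ : 0 ≤ b₁ * A - b₂ := by
    refine nonneg_of_mul_nonneg_right (a := 2 * b₂) ?_ (by positivity)
    nlinarith
  have hv₀ : 0 ≤ b₂ - b₃ * B := by
    refine nonneg_of_mul_nonneg_right (a := 2 * b₂) ?_ (by positivity)
    nlinarith
  have key := mul_add_mul_le_of_sq_sub_sq_eq (u₁ := b₁ * s) (v₁ := b₃ * t) (a := a₁) (b := a₂)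
    hu₀ hv₀ (by linear_combination (-b₁ ^ 2) * hs - eA) (by linear_combination (-b₃ ^ 2) * ht - eB)
  linear_combination 2 * key + eA + eB
end

section
/- (Parallel realisations are homeomorphisms.) Let (X,d,≪,≤,τ) be a Lorentzian pre-length space in which τ is continuous, τ(x,x) = 0 for all x ∈ X, and which is strongly causal in the sense that the family of timelike diamonds I(p,q) = {z ∈ X : p ≪ z ≪ q} is a subbasis for the metric topology of (X,d). Let α, β : ℝ → X be continuous curves with α(s) ≪ α(t) and β(s) ≪ β(t) for all s < t. Let f : α(ℝ) ∪ β(ℝ) → ℝ² be a map such that τ(p,q) = τ̄(f(p),f(q)) for all p, q ∈ α(ℝ) ∪ β(ℝ), such that p ≤ q holds if and only if f(p) ≤ f(q) holds in ℝ^{1,1}, and such that f(α(ℝ)) and f(β(ℝ)) are each a full timelike affine line in ℝ² (an affine line whose direction vector (v₀,v₁) satisfies |v₀| > |v₁|), these two lines being parallel or equal. Then f is injective and is a homeomorphism onto its image, where α(ℝ) ∪ β(ℝ) carries the subspace topology from (X,d) and the image carries the subspace topology from ℝ². -/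
/-!
Statement 16: Parallel realisations are homeomorphisms.  In a strongly causal
Lorentzian pre-length space with continuous `τ` and `τ(x,x) = 0`, any `τ`- and
`≤`-preserving map `f` from the union of two timelike lines `α, β` onto two
parallel (or equal) full timelike affine lines of the Minkowski plane is
injective and a homeomorphism onto its image (with the subspace topologies).
-/

/-- Causal relation of two-dimensional Minkowski space `ℝ^{1,1}`. -/
def MinkLe (p q : ℝ × ℝ) : Prop := |q.2 - p.2| ≤ q.1 - p.1

theorem minkTau_pos_iff (p q : ℝ × ℝ) : 0 < MinkTau p q ↔ |q.2 - p.2| < q.1 - p.1 := by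
  unfold MinkTau
  split_ifs with h
  · have h0 := abs_nonneg (q.2 - p.2)
    rw [Real.sqrt_pos, sub_pos, sq_lt_sq, abs_of_nonneg (h0.trans h)]
  · exact iff_of_false (lt_irrefl _) fun h' => h h'.le

/-- Every point of a timelike affine line lies between two points of the line whose
Minkowski diamond is contained in a given ball. -/
theorem exists_minkowski_diamond_subset_ball {v : ℝ × ℝ} (hv : |v.2| < |v.1|) (x : ℝ × ℝ)
    {ε : ℝ} (hε : 0 < ε) :
    ∃ c : ℝ, (|x.2 - (x - c • v).2| < x.1 - (x - c • v).1) ∧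
      (|(x + c • v).2 - x.2| < (x + c • v).1 - x.1) ∧
      ∀ y : ℝ × ℝ, |y.2 - (x - c • v).2| < y.1 - (x - c • v).1 →
        |(x + c • v).2 - y.2| < (x + c • v).1 - y.1 → dist y x < ε := by
  have hv1 : v.1 ≠ 0 := abs_pos.1 ((abs_nonneg _).trans_lt hv)
  have h1 : ε / (3 * v.1) * v.1 = ε / 3 := by field_simp
  have h2 : |ε / (3 * v.1) * v.2| < ε / 3 := by
    rw [← abs_of_pos (show 0 < ε / 3 by positivity), ← h1, abs_mul, abs_mul]
    exact mul_lt_mul_of_pos_left hv (by positivity)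
  refine ⟨ε / (3 * v.1), ?_, ?_, ?_⟩
  · simpa [h1] using h2
  · simpa [h1] using h2
  · intro y hy hy'
    simp only [Prod.fst_sub, Prod.snd_sub, Prod.fst_add, Prod.snd_add, Prod.smul_fst,
      Prod.smul_snd, smul_eq_mul, h1] at hy hy'
    rw [abs_lt] at h2 hy hy'
    rw [Prod.dist_eq, max_lt_iff, Real.dist_eq, Real.dist_eq, abs_lt, abs_lt]
    refine ⟨⟨?_, ?_⟩, ?_, ?_⟩ <;> linarith

section ParallelRealisation

open Topology Filter

variable {X : Type*} [TopologicalSpace X] {ll : X → X → Prop} {S : Set X} {f : X → ℝ × ℝ}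
  {γ : ℝ → X}

theorem continuousWithinAt_of_image_eq_timelike_line
    (hopen : ∀ p q : X, IsOpen {z : X | ll p z ∧ ll z q})
    (hf : ∀ p ∈ S, ∀ q ∈ S, (ll p q ↔ |(f q).2 - (f p).2| < (f q).1 - (f p).1))
    (hγ : Set.range γ ⊆ S) {w v : ℝ × ℝ} (hv : |v.2| < |v.1|)
    (hline : f '' Set.range γ = Set.range (fun r : ℝ => w + r • v))
    {p : X} (hp : p ∈ Set.range γ) : ContinuousWithinAt f S p := by
  rw [ContinuousWithinAt, Metric.tendsto_nhds]
  intro ε hε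
  obtain ⟨c, h1, h2, h3⟩ := exists_minkowski_diamond_subset_ball hv (f p) hε
  obtain ⟨r, hr⟩ : f p ∈ Set.range (fun r : ℝ => w + r • v) :=
    hline ▸ Set.mem_image_of_mem f hp
  obtain ⟨a, ha, hfa⟩ : f p - c • v ∈ f '' Set.range γ := by
    rw [hline]
    exact ⟨r - c, by rw [← hr]; module⟩
  obtain ⟨b, hb, hfb⟩ : f p + c • v ∈ f '' Set.range γ := by
    rw [hline]
    exact ⟨r + c, by rw [← hr]; module⟩
  rw [← hfa] at h1 h3
  rw [← hfb] at h2 h3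
  have hmem : {z : X | ll a z ∧ ll z b} ∈ 𝓝 p :=
    (hopen a b).mem_nhds ⟨(hf _ (hγ ha) _ (hγ hp)).2 h1, (hf _ (hγ hp) _ (hγ hb)).2 h2⟩
  filter_upwards [mem_nhdsWithin_of_mem_nhds hmem, self_mem_nhdsWithin] with q hq hqS
  exact h3 _ ((hf _ (hγ ha) _ hqS).1 hq.1) ((hf _ hqS _ (hγ hb)).1 hq.2)

theorem leftInverse_continuousWithinAt_of_timelike_curve
    (htrans : ∀ x y z, ll x y → ll y z → ll x z)
    (hopen : ∀ p q : X, IsOpen {z : X | ll p z ∧ ll z q})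
    (hnhds : ∀ p : X, 𝓝 p =
      ⨅ s ∈ {s : Set X | p ∈ s ∧ ∃ a b : X, s = {z : X | ll a z ∧ ll z b}}, 𝓟 s)
    (hf : ∀ p ∈ S, ∀ q ∈ S, (ll p q ↔ |(f q).2 - (f p).2| < (f q).1 - (f p).1))
    (hγ : Set.range γ ⊆ S) (hcont : Continuous γ) (htl : ∀ s t : ℝ, s < t → ll (γ s) (γ t))
    {g : ℝ × ℝ → X} (hg : ∀ p ∈ S, g (f p) = p)
    {p : X} (hp : p ∈ Set.range γ) : ContinuousWithinAt g (f '' S) (f p) := by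
  rw [ContinuousWithinAt, hg p (hγ hp), hnhds p]
  simp only [tendsto_iInf, tendsto_principal]
  rintro _ ⟨hpab, a, b, rfl⟩
  obtain ⟨t, rfl⟩ := hp
  have hmem : γ ⁻¹' {z : X | ll a z ∧ ll z b} ∈ 𝓝 t :=
    ((hopen a b).preimage hcont).mem_nhds hpab
  obtain ⟨ε, hε, hball⟩ := Metric.mem_nhds_iff.1 hmem
  have hlo : ll a (γ (t - ε / 2)) :=
    (hball (by rw [Metric.mem_ball, Real.dist_eq, abs_lt]; constructor <;> linarith)).1
  have hhi : ll (γ (t + ε / 2)) b :=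
    (hball (by rw [Metric.mem_ball, Real.dist_eq, abs_lt]; constructor <;> linarith)).2
  have hS : ∀ s, γ s ∈ S := fun s => hγ ⟨s, rfl⟩
  have h1 := (hf _ (hS _) _ (hS _)).1 (htl (t - ε / 2) t (by linarith))
  have h2 := (hf _ (hS _) _ (hS _)).1 (htl t (t + ε / 2) (by linarith))
  have e1 : ∀ᶠ y in 𝓝 (f (γ t)),
      |y.2 - (f (γ (t - ε / 2))).2| < y.1 - (f (γ (t - ε / 2))).1 :=
    (isOpen_lt (by fun_prop) (by fun_prop)).mem_nhds h1
  have e2 : ∀ᶠ y in 𝓝 (f (γ t)),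
      |(f (γ (t + ε / 2))).2 - y.2| < (f (γ (t + ε / 2))).1 - y.1 :=
    (isOpen_lt (by fun_prop) (by fun_prop)).mem_nhds h2
  filter_upwards [mem_nhdsWithin_of_mem_nhds e1, mem_nhdsWithin_of_mem_nhds e2,
    self_mem_nhdsWithin] with y hy1 hy2 hy
  obtain ⟨q, hq, rfl⟩ := hy
  rw [hg q hq]
  exact ⟨htrans _ _ _ hlo ((hf _ (hS _) _ hq).2 hy1),
    htrans _ _ _ ((hf _ hq _ (hS _)).2 hy2) hhi⟩

end ParallelRealisation

theorem parallel_realisation_is_homeomorphism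
    (X : Type*) [MetricSpace X]
    (le ll : X → X → Prop) (tau : X → X → ℝ)
    -- Lorentzian pre-length space axioms
    (h_le_refl : ∀ x, le x x)
    (h_le_trans : ∀ x y z, le x y → le y z → le x z)
    (h_ll_trans : ∀ x y z, ll x y → ll y z → ll x z)
    (h_ll_le : ∀ x y, ll x y → le x y)
    (h_tau_nonneg : ∀ x y, 0 ≤ tau x y)
    (h_tau_zero : ∀ x y, ¬ le x y → tau x y = 0)
    (h_tau_pos : ∀ x y, 0 < tau x y ↔ ll x y)
    (h_rev_tri : ∀ x y z, le x y → le y z → tau x y + tau y z ≤ tau x z)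
    -- τ is continuous and vanishes on the diagonal
    (h_tau_cont : Continuous (fun p : X × X => tau p.1 p.2))
    (h_tau_refl : ∀ x, tau x x = 0)
    -- strong causality: timelike diamonds form a subbasis of the metric
    -- topology
    (h_strongly_causal : (inferInstance : TopologicalSpace X) =
      TopologicalSpace.generateFrom
        {S : Set X | ∃ p q : X, S = {z : X | ll p z ∧ ll z q}})
    -- α, β are (complete) timelike lines
    (α β : ℝ → X)
    (hα_cont : Continuous α) (hβ_cont : Continuous β)
    (hα_tl : ∀ s t : ℝ, s < t → ll (α s) (α t))
    (hβ_tl : ∀ s t : ℝ, s < t → ll (β s) (β t))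
    -- f is a parallel realisation of α and β
    (f : X → ℝ × ℝ)
    (h_f_tau : ∀ p ∈ Set.range α ∪ Set.range β, ∀ q ∈ Set.range α ∪ Set.range β,
      tau p q = MinkTau (f p) (f q))
    (h_f_le : ∀ p ∈ Set.range α ∪ Set.range β, ∀ q ∈ Set.range α ∪ Set.range β,
      (le p q ↔ MinkLe (f p) (f q)))
    -- the images are full parallel (or equal) timelike affine lines
    (h_f_lines : ∃ w z v : ℝ × ℝ, |v.2| < |v.1| ∧
      f '' Set.range α = Set.range (fun r : ℝ => w + r • v) ∧
      f '' Set.range β = Set.range (fun r : ℝ => z + r • v)) :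
    -- f is injective and a homeomorphism onto its image
    Set.InjOn f (Set.range α ∪ Set.range β) ∧
    ContinuousOn f (Set.range α ∪ Set.range β) ∧
    ∃ g : ℝ × ℝ → X,
      (∀ p ∈ Set.range α ∪ Set.range β, g (f p) = p) ∧
      ContinuousOn g (f '' (Set.range α ∪ Set.range β)) := by
  have hopen : ∀ p q : X, IsOpen {z : X | ll p z ∧ ll z q} := by
    intro p q
    simp only [← h_tau_pos]
    have h1 : Continuous fun z => tau p z :=
      h_tau_cont.comp (by fun_prop : Continuous fun z => (p, z))
    have h2 : Continuous fun z => tau z q :=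
      h_tau_cont.comp (by fun_prop : Continuous fun z => (z, q))
    exact (isOpen_lt continuous_const h1).inter (isOpen_lt continuous_const h2)
  have hnhds : ∀ p : X, nhds p =
      ⨅ s ∈ {s : Set X | p ∈ s ∧ ∃ a b : X, s = {z : X | ll a z ∧ ll z b}},
        Filter.principal s := fun p =>
    (congrArg (fun t => @nhds X t p) h_strongly_causal).trans
      TopologicalSpace.nhds_generateFrom
  have hf : ∀ p ∈ Set.range α ∪ Set.range β, ∀ q ∈ Set.range α ∪ Set.range β,
      (ll p q ↔ |(f q).2 - (f p).2| < (f q).1 - (f p).1) := fun p hp q hq => by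
    rw [← h_tau_pos, h_f_tau p hp q hq, minkTau_pos_iff]
  have hα : Set.range α ⊆ Set.range α ∪ Set.range β := Set.subset_union_left
  have hβ : Set.range β ⊆ Set.range α ∪ Set.range β := Set.subset_union_right
  have hinj : Set.InjOn f (Set.range α ∪ Set.range β) := by
    intro p hp q hq hpq
    have hle : le p q := (h_f_le p hp q hq).2 (by simp [MinkLe, hpq])
    have hge : le q p := (h_f_le q hq p hp).2 (by simp [MinkLe, hpq])
    refine (pure_le_nhds_iff.1 ?_ : q = p).symm
    rw [hnhds p]
    refine le_iInf₂ ?_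
    rintro _ ⟨hpab, a, b, rfl⟩
    obtain ⟨hap, hpb⟩ : ll a p ∧ ll p b := hpab
    rw [Filter.le_principal_iff, Filter.mem_pure]
    refine ⟨(h_tau_pos _ _).1 ?_, (h_tau_pos _ _).1 ?_⟩
    · linarith [h_rev_tri a p q (h_ll_le _ _ hap) hle, (h_tau_pos _ _).2 hap, h_tau_nonneg p q]
    · linarith [h_rev_tri q p b hge (h_ll_le _ _ hpb), (h_tau_pos _ _).2 hpb, h_tau_nonneg q p]
  obtain ⟨w, z, v, hv, hw, hz⟩ := h_f_lines
  refine ⟨hinj, ?_, ?_⟩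
  · rintro p (hp | hp)
    · exact continuousWithinAt_of_image_eq_timelike_line hopen hf hα hv hw hp
    · exact continuousWithinAt_of_image_eq_timelike_line hopen hf hβ hv hz hp
  · have : Nonempty X := ⟨α 0⟩
    have hg : ∀ p ∈ Set.range α ∪ Set.range β,
        Function.invFunOn f (Set.range α ∪ Set.range β) (f p) = p :=
      fun p hp => hinj.leftInvOn_invFunOn hp
    refine ⟨_, hg, ?_⟩
    rintro _ ⟨p, hp | hp, rfl⟩
    · exact leftInverse_continuousWithinAt_of_timelike_curve h_ll_trans hopen hnhds hf hα
        hα_cont hα_tl hg hp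
    · exact leftInverse_continuousWithinAt_of_timelike_curve h_ll_trans hopen hnhds hf hβ
        hβ_cont hβ_tl hg hp
end
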